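/- arXiv:1603.09589 — 4 statements merged into one kernel-verified Lean document; each statement's English description precedes it below -/
import Mathlib

section
/- Let P, Q be finite graded posets of ranks r_P, r_Q respectively. Then the maximal-chain-weighted expected down-degree of P × Q equals the sum of the maximal-chain-weighted expected down-degrees of P and Q. Here the maximal-chain-weighted expectation of down-degree on a graded poset R of rank r is (1/((r+1)·#M(R))) Σ_{c∈M(R)} Σ_{p∈c} d_R(p), where M(R) is the set of maximal chains. -/
open scoped BigOperators

/-- The down-degree of `p`: the number of elements covered by `p`. -/
noncomputable def downDeg (P : Type*) [PartialOrder P] (p : P) : ℕ :=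
  {q : P | q ⋖ p}.ncard

/-- The maximal-chain-weighted expected down-degree of a graded poset of rank `r`:
`(1/((r+1)·#M(P))) Σ_{c ∈ M(P)} Σ_{p ∈ c} d(p)`, where `M(P)` is the set of maximal chains. -/
noncomputable def EYgraded (P : Type*) [PartialOrder P] (r : ℕ) : ℚ :=
  (∑ᶠ c ∈ {c : Set P | IsMaxChain (· ≤ ·) c}, ∑ᶠ p ∈ c, (downDeg P p : ℚ)) /
    (((r : ℚ) + 1) * ({c : Set P | IsMaxChain (· ≤ ·) c}.ncard : ℚ))

namespace MCAux

/-- Maximal chains inside a subset. -/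
def MC {α : Type*} [PartialOrder α] (S : Set α) : Set (Set α) :=
  {c | ∀ x, x ∈ c ↔ x ∈ S ∧ ∀ y ∈ c, x ≤ y ∨ y ≤ x}

section basic
variable {α : Type*} [PartialOrder α]

lemma isMaxChain_iff (c : Set α) : IsMaxChain (· ≤ ·) c ↔ c ∈ MC (Set.univ : Set α) := by
  constructor
  · rintro ⟨h1, h2⟩ x
    constructor
    · intro hx
      exact ⟨trivial, fun y hy => h1.total hx hy⟩
    · rintro ⟨-, hx⟩
      have : c = insert x c := h2 (h1.insert (fun b hb _ => hx b hb)) (Set.subset_insert _ _)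
      rw [this]; exact Set.mem_insert _ _
  · intro h
    refine ⟨fun x hx y hy _ => ((h x).1 hx).2 y hy, ?_⟩
    intro t ht hct
    refine hct.antisymm fun x hx => (h x).2 ⟨trivial, fun y hy => ht.total hx (hct hy)⟩

lemma mem_of_MC_Iic {p : α} {c : Set α} (hc : c ∈ MC (Set.Iic p)) : p ∈ c :=
  (hc p).2 ⟨le_refl p, fun y hy => Or.inr ((hc y).1 hy).1⟩

lemma mem_of_MC_Ici {p : α} {c : Set α} (hc : c ∈ MC (Set.Ici p)) : p ∈ c :=
  (hc p).2 ⟨le_refl p, fun y hy => Or.inl ((hc y).1 hy).1⟩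

lemma inter_Iic {p : α} {c : Set α} (hc : c ∈ MC (Set.univ : Set α)) (hp : p ∈ c) :
    c ∩ Set.Iic p ∈ MC (Set.Iic p) := by
  intro x
  constructor
  · rintro ⟨hx, hxp⟩
    exact ⟨hxp, fun y hy => ((hc x).1 hx).2 y hy.1⟩
  · rintro ⟨hxp, hx⟩
    refine ⟨(hc x).2 ⟨trivial, fun y hy => ?_⟩, hxp⟩
    rcases ((hc p).1 hp).2 y hy with h | h
    · exact Or.inl (le_trans hxp h)
    · exact hx y ⟨hy, h⟩

lemma inter_Ici {p : α} {c : Set α} (hc : c ∈ MC (Set.univ : Set α)) (hp : p ∈ c) :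
    c ∩ Set.Ici p ∈ MC (Set.Ici p) := by
  intro x
  constructor
  · rintro ⟨hx, hxp⟩
    exact ⟨hxp, fun y hy => ((hc x).1 hx).2 y hy.1⟩
  · rintro ⟨hxp, hx⟩
    refine ⟨(hc x).2 ⟨trivial, fun y hy => ?_⟩, hxp⟩
    rcases ((hc p).1 hp).2 y hy with h | h
    · exact hx y ⟨hy, h⟩
    · exact Or.inr (le_trans h hxp)

lemma union_mem {p : α} {a b : Set α} (ha : a ∈ MC (Set.Iic p)) (hb : b ∈ MC (Set.Ici p)) :
    a ∪ b ∈ MC (Set.univ : Set α) := by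
  have hpa := mem_of_MC_Iic ha
  have hpb := mem_of_MC_Ici hb
  have ha1 : ∀ x ∈ a, x ≤ p := fun x hx => ((ha x).1 hx).1
  have hb1 : ∀ x ∈ b, p ≤ x := fun x hx => ((hb x).1 hx).1
  intro x
  constructor
  · rintro (hx | hx)
    · refine ⟨trivial, ?_⟩
      rintro y (hy | hy)
      · exact ((ha x).1 hx).2 y hy
      · exact Or.inl ((ha1 x hx).trans (hb1 y hy))
    · refine ⟨trivial, ?_⟩
      rintro y (hy | hy)
      · exact Or.inr ((ha1 y hy).trans (hb1 x hx))
      · exact ((hb x).1 hx).2 y hy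
  · rintro ⟨-, hx⟩
    rcases hx p (Or.inl hpa) with h | h
    · exact Or.inl ((ha x).2 ⟨h, fun y hy => hx y (Or.inl hy)⟩)
    · exact Or.inr ((hb x).2 ⟨h, fun y hy => hx y (Or.inr hy)⟩)

lemma union_inter_Iic {p : α} {a b : Set α} (ha : a ∈ MC (Set.Iic p)) (hb : b ∈ MC (Set.Ici p)) :
    (a ∪ b) ∩ Set.Iic p = a := by
  ext x
  constructor
  · rintro ⟨hx | hx, hxp⟩
    · exact hx
    · have : x = p := le_antisymm hxp ((hb x).1 hx).1
      rw [this]; exact mem_of_MC_Iic ha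
  · intro hx
    exact ⟨Or.inl hx, ((ha x).1 hx).1⟩

lemma union_inter_Ici {p : α} {a b : Set α} (ha : a ∈ MC (Set.Iic p)) (hb : b ∈ MC (Set.Ici p)) :
    (a ∪ b) ∩ Set.Ici p = b := by
  ext x
  constructor
  · rintro ⟨hx | hx, hxp⟩
    · have : x = p := le_antisymm ((ha x).1 hx).1 hxp
      rw [this]; exact mem_of_MC_Ici hb
    · exact hx
  · intro hx
    exact ⟨Or.inr hx, ((hb x).1 hx).1⟩

lemma inter_union {p : α} {c : Set α} (hc : c ∈ MC (Set.univ : Set α)) (hp : p ∈ c) :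
    (c ∩ Set.Iic p) ∪ (c ∩ Set.Ici p) = c := by
  ext x
  constructor
  · rintro (h | h) <;> exact h.1
  · intro hx
    rcases ((hc x).1 hx).2 p hp with h | h
    · exact Or.inl ⟨hx, h⟩
    · exact Or.inr ⟨hx, h⟩

/-- Number of maximal chains below `p`. -/
noncomputable def D (p : α) : ℕ := Nat.card (MC (Set.Iic p))
/-- Number of maximal chains above `p`. -/
noncomputable def U (p : α) : ℕ := Nat.card (MC (Set.Ici p))

/-- Splitting at `p`. -/
def glue (p : α) : {c : Set α // c ∈ MC (Set.univ : Set α) ∧ p ∈ c} ≃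
    MC (Set.Iic p) × MC (Set.Ici p) where
  toFun c := (⟨c.1 ∩ Set.Iic p, inter_Iic c.2.1 c.2.2⟩, ⟨c.1 ∩ Set.Ici p, inter_Ici c.2.1 c.2.2⟩)
  invFun ab := ⟨ab.1.1 ∪ ab.2.1, union_mem ab.1.2 ab.2.2, Or.inl (mem_of_MC_Iic ab.1.2)⟩
  left_inv c := Subtype.ext (inter_union c.2.1 c.2.2)
  right_inv ab := Prod.ext (Subtype.ext (union_inter_Iic ab.1.2 ab.2.2))
    (Subtype.ext (union_inter_Ici ab.1.2 ab.2.2))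

lemma card_through (p : α) :
    Nat.card {c : Set α // c ∈ MC (Set.univ : Set α) ∧ p ∈ c} = D p * U p := by
  rw [Nat.card_congr (glue p), Nat.card_prod]; rfl

lemma exists_through (p : α) : ∃ c ∈ MC (Set.univ : Set α), p ∈ c := by
  obtain ⟨M, hM, h⟩ := (IsChain.singleton (r := fun x y : α => x ≤ y) (a := p)).exists_maxChain
  exact ⟨M, (isMaxChain_iff M).1 hM, h rfl⟩

lemma exists_Iic (p : α) : (MC (Set.Iic p)).Nonempty := by
  obtain ⟨c, hc, hp⟩ := exists_through p
  exact ⟨_, inter_Iic hc hp⟩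

lemma exists_Ici (p : α) : (MC (Set.Ici p)).Nonempty := by
  obtain ⟨c, hc, hp⟩ := exists_through p
  exact ⟨_, inter_Ici hc hp⟩

lemma D_of_isMin {p : α} (hp : IsMin p) : D p = 1 := by
  have : MC (Set.Iic p) = {{p}} := by
    ext c
    rw [Set.mem_singleton_iff]
    constructor
    · intro hc
      ext x
      rw [Set.mem_singleton_iff]
      constructor
      · intro hx; exact hp.eq_of_le ((hc x).1 hx).1
      · rintro rfl; exact mem_of_MC_Iic hc
    · rintro rfl x
      rw [Set.mem_singleton_iff]
      constructor
      · rintro rfl; exact ⟨le_refl x, fun y hy => Or.inr (le_of_eq hy)⟩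
      · rintro ⟨h, -⟩; exact hp.eq_of_le h
  rw [D, this]; simp

lemma insert_mem {p q : α} (h : q ⋖ p) {c : Set α} (hc : c ∈ MC (Set.Iic q)) :
    insert p c ∈ MC (Set.Iic p) := by
  have h1 : ∀ x ∈ c, x ≤ q := fun x hx => ((hc x).1 hx).1
  intro x
  constructor
  · rintro (rfl | hx)
    · refine ⟨le_refl x, ?_⟩
      rintro y (rfl | hy)
      · exact Or.inl le_rfl
      · exact Or.inr ((h1 y hy).trans h.le)
    · refine ⟨(h1 x hx).trans h.le, ?_⟩
      rintro y (rfl | hy)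
      · exact Or.inl ((h1 x hx).trans h.le)
      · exact ((hc x).1 hx).2 y hy
  · rintro ⟨hxp, hx⟩
    rcases eq_or_lt_of_le (show x ≤ p from hxp) with rfl | hlt
    · exact Or.inl rfl
    · refine Or.inr ((hc x).2 ⟨?_, fun y hy => hx y (Or.inr hy)⟩)
      rcases hx q (Or.inr (mem_of_MC_Iic hc)) with h' | h'
      · exact h'
      · rcases h.eq_or_eq h' hlt.le with e | e
        · exact le_of_eq e
        · exact absurd e hlt.ne

lemma notMem_of_covBy {p q : α} (h : q ⋖ p) {c : Set α} (hc : c ∈ MC (Set.Iic q)) : p ∉ c :=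
  fun hp => h.lt.not_ge ((hc p).1 hp).1

lemma exists_insert [Finite α] {p : α} (hp : ¬ IsMin p) {c : Set α} (hc : c ∈ MC (Set.Iic p)) :
    ∃ q, q ⋖ p ∧ ∃ a ∈ MC (Set.Iic q), insert p a = c := by
  have hpc := mem_of_MC_Iic hc
  have hne : (c \ {p}).Nonempty := by
    by_contra hne
    rw [Set.not_nonempty_iff_eq_empty] at hne
    obtain ⟨x, hx⟩ := not_isMin_iff.1 hp
    have hxc : x ∈ c := (hc x).2 ⟨hx.le, fun y hy => by
      have : y = p := by
        by_contra hyp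
        have : y ∈ c \ {p} := ⟨hy, hyp⟩
        rw [hne] at this; exact this
      rw [this]; exact Or.inl hx.le⟩
    have : x ∈ c \ {p} := ⟨hxc, hx.ne⟩
    rw [hne] at this; exact this
  obtain ⟨q, hq⟩ := (Set.toFinite (c \ {p})).exists_maximal hne
  have hqc : q ∈ c := hq.1.1
  have hqp : q < p := lt_of_le_of_ne ((hc q).1 hqc).1 hq.1.2
  have hmax : ∀ y ∈ c, y ≠ p → y ≤ q := by
    intro y hy hyp
    rcases ((hc q).1 hqc).2 y hy with h | h
    · exact hq.2 ⟨hy, hyp⟩ h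
    · exact h
  have hcov : q ⋖ p := by
    refine ⟨hqp, fun z hz1 hz2 => ?_⟩
    have hzc : z ∈ c := (hc z).2 ⟨hz2.le, fun y hy => by
      by_cases hyp : y = p
      · rw [hyp]; exact Or.inl hz2.le
      · exact Or.inr ((hmax y hy hyp).trans hz1.le)⟩
    exact hz1.not_ge (hmax z hzc hz2.ne)
  refine ⟨q, hcov, c \ {p}, ?_, ?_⟩
  · intro x
    constructor
    · rintro ⟨hx, hxp⟩
      exact ⟨hmax x hx hxp, fun y hy => ((hc x).1 hx).2 y hy.1⟩
    · rintro ⟨hxq, hx⟩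
      refine ⟨(hc x).2 ⟨le_trans hxq hqp.le, fun y hy => ?_⟩, (lt_of_le_of_lt hxq hqp).ne⟩
      by_cases hyp : y = p
      · rw [hyp]; exact Or.inl (le_trans hxq hqp.le)
      · exact hx y ⟨hy, hyp⟩
  · rw [Set.insert_sdiff_singleton, Set.insert_eq_of_mem hpc]

open Classical in
lemma D_rec [Fintype α] {p : α} (hp : ¬ IsMin p) :
    D p = ∑ q ∈ Finset.univ.filter (fun q => q ⋖ p), D q := by
  let f : (Σ q : {q : α // q ⋖ p}, MC (Set.Iic q.1)) → MC (Set.Iic p) :=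
    fun z => ⟨insert p z.2.1, insert_mem z.1.2 z.2.2⟩
  have hf : Function.Bijective f := by
    constructor
    · rintro ⟨⟨q, hq⟩, ⟨c, hc⟩⟩ ⟨⟨q', hq'⟩, ⟨c', hc'⟩⟩ h
      have h1 : insert p c = insert p c' := congrArg Subtype.val h
      have h2 : c = c' := by
        rw [← Set.insert_sdiff_self_of_notMem (notMem_of_covBy hq hc), h1,
          Set.insert_sdiff_self_of_notMem (notMem_of_covBy hq' hc')]
      subst h2
      have h3 : q = q' := le_antisymm ((hc' q).1 (mem_of_MC_Iic hc)).1
        ((hc q').1 (mem_of_MC_Iic hc')).1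
      subst h3
      rfl
    · rintro ⟨c, hc⟩
      obtain ⟨q, hq, a, ha, h⟩ := exists_insert hp hc
      exact ⟨⟨⟨q, hq⟩, ⟨a, ha⟩⟩, Subtype.ext h⟩
  rw [D, ← Nat.card_congr (Equiv.ofBijective f hf), Nat.card_sigma]
  exact (Finset.sum_subtype (Finset.univ.filter (fun q => q ⋖ p)) (fun x => by simp) D).symm

end basic

section rank
variable {α : Type*} [PartialOrder α]

/-- `ρ` is a rank function. -/
def HR (ρ : α → ℕ) : Prop := ∀ p, ∀ c ∈ MC (Set.Iic p), c.ncard = ρ p + 1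

lemma rk_min {ρ : α → ℕ} (h : HR ρ) {p : α} (hp : IsMin p) : ρ p = 0 := by
  obtain ⟨c, hc⟩ := exists_Iic p
  have : c = {p} := by
    ext x
    rw [Set.mem_singleton_iff]
    constructor
    · intro hx; exact hp.eq_of_le ((hc x).1 hx).1
    · rintro rfl; exact mem_of_MC_Iic hc
  have h1 := h p c hc
  rw [this, Set.ncard_singleton] at h1
  omega

lemma rk_cov [Finite α] {ρ : α → ℕ} (h : HR ρ) {p q : α} (hpq : q ⋖ p) : ρ p = ρ q + 1 := by
  obtain ⟨c, hc⟩ := exists_Iic q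
  have h1 := h q c hc
  have h2 := h p _ (insert_mem hpq hc)
  rw [Set.ncard_insert_of_notMem (notMem_of_covBy hpq hc) (Set.toFinite _)] at h2
  omega

lemma rk_lt [Finite α] {ρ : α → ℕ} (h : HR ρ) {c : Set α} (hc : c ∈ MC (Set.univ : Set α))
    {p q : α} (hp : p ∈ c) (hq : q ∈ c) (hpq : p < q) : ρ p < ρ q := by
  have h1 := h p _ (inter_Iic hc hp)
  have h2 := h q _ (inter_Iic hc hq)
  have : (c ∩ Set.Iic p).ncard < (c ∩ Set.Iic q).ncard := by
    apply Set.ncard_lt_ncard _ (Set.toFinite _)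
    refine ⟨fun x hx => ⟨hx.1, le_trans hx.2 hpq.le⟩, fun hs => ?_⟩
    exact hpq.not_ge (hs ⟨hq, le_refl q⟩).2
  omega

lemma ncard_glue [Finite α] {p : α} {a b : Set α} (ha : a ∈ MC (Set.Iic p))
    (hb : b ∈ MC (Set.Ici p)) : (a ∪ b).ncard + 1 = a.ncard + b.ncard := by
  rw [← Set.ncard_union_add_ncard_inter a b (Set.toFinite _) (Set.toFinite _)]
  have : a ∩ b = {p} := by
    ext x
    rw [Set.mem_singleton_iff]
    constructor
    · rintro ⟨h1, h2⟩; exact le_antisymm ((ha x).1 h1).1 ((hb x).1 h2).1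
    · rintro rfl; exact ⟨mem_of_MC_Iic ha, mem_of_MC_Ici hb⟩
  rw [this, Set.ncard_singleton]

lemma exists_rank [Finite α] {r : ℕ} (h : ∀ c ∈ MC (Set.univ : Set α), c.ncard = r + 1) :
    ∃ ρ : α → ℕ, HR ρ ∧ (∀ p, ρ p ≤ r) ∧ ∀ p, ∀ c ∈ MC (Set.Ici p), c.ncard = r - ρ p + 1 := by
  have key : ∀ p : α, ∃ n : ℕ, n ≤ r ∧ (∀ c ∈ MC (Set.Iic p), c.ncard = n + 1) ∧
      ∀ c ∈ MC (Set.Ici p), c.ncard = r - n + 1 := by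
    intro p
    obtain ⟨a, ha⟩ := exists_Iic p
    obtain ⟨b, hb⟩ := exists_Ici p
    have e0 := ncard_glue ha hb
    have e1 := h _ (union_mem ha hb)
    have pa : 0 < a.ncard := (Set.ncard_pos (Set.toFinite _)).2 ⟨p, mem_of_MC_Iic ha⟩
    have pb : 0 < b.ncard := (Set.ncard_pos (Set.toFinite _)).2 ⟨p, mem_of_MC_Ici hb⟩
    refine ⟨a.ncard - 1, by omega, fun c hc => ?_, fun c hc => ?_⟩
    · have e2 := ncard_glue hc hb
      have e3 := h _ (union_mem hc hb)
      omega
    · have e2 := ncard_glue ha hc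
      have e3 := h _ (union_mem ha hc)
      omega
  choose ρ h1 h2 h3 using key
  exact ⟨ρ, h2, h1, h3⟩

lemma MC_dual (S : Set α) : (MC (α := αᵒᵈ) S : Set (Set α)) = MC (α := α) S := by
  ext c
  exact forall_congr' fun x => iff_congr Iff.rfl (and_congr Iff.rfl
    (forall_congr' fun y => forall_congr' fun _ => Or.comm))

lemma U_eq (p : α) : U p = D (α := αᵒᵈ) (OrderDual.toDual p) := by
  show Nat.card (MC (α := α) (Set.Ici p)) = _
  rw [← MC_dual]; rfl

end rank

section prod
variable {P Q : Type*} [PartialOrder P] [PartialOrder Q] [Fintype P] [Fintype Q]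

open Classical in
lemma sum_cov (F : P × Q → ℕ) (p : P) (q : Q) :
    ∑ z ∈ Finset.univ.filter (fun z => z ⋖ (p, q)), F z =
    ∑ x ∈ Finset.univ.filter (fun x => x ⋖ p), F (x, q) +
    ∑ y ∈ Finset.univ.filter (fun y => y ⋖ q), F (p, y) := by
  have : ∀ x y, (if (x, y) ⋖ (p, q) then F (x, y) else 0) =
      (if y = q then (if x ⋖ p then F (x, y) else 0) else 0) +
      (if x = p then (if y ⋖ q then F (x, y) else 0) else 0) := by
    intro x y
    rw [Prod.mk_covBy_mk_iff]
    by_cases h1 : y = q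
    · subst h1
      have : ¬ y ⋖ y := fun h => h.lt.ne rfl
      simp [this]
    · by_cases h2 : x = p
      · simp [h1, h2]
      · simp [h1, h2]
  simp only [Finset.sum_filter, Fintype.sum_prod_type, this, Finset.sum_add_distrib]
  congr 1
  · exact Finset.sum_congr rfl fun x _ => by simp
  · rw [Finset.sum_comm]
    exact Finset.sum_congr rfl fun x _ => by simp

lemma isMin_prod (p : P) (q : Q) : IsMin (p, q) ↔ IsMin p ∧ IsMin q := by
  simpa using Prod.isMin_iff (x := (p, q))

lemma D_prod {ρ : P → ℕ} {σ : Q → ℕ} (hρ : HR ρ) (hσ : HR σ) :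
    ∀ z : P × Q, D z = D z.1 * D z.2 * (ρ z.1 + σ z.2).choose (ρ z.1) := by
  classical
  intro z
  induction z using WellFoundedLT.induction with
  | ind z ih =>
  obtain ⟨p, q⟩ := z
  simp only
  by_cases hz : IsMin (p, q)
  · obtain ⟨hp, hq⟩ := (isMin_prod p q).1 hz
    rw [D_of_isMin hz, D_of_isMin hp, D_of_isMin hq, rk_min hρ hp]
    simp
  have e1 : ∀ x ∈ Finset.univ.filter (fun x => x ⋖ p),
      D (x, q) = D x * D q * (ρ p - 1 + σ q).choose (ρ p - 1) := by
    intro x hx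
    have hx : x ⋖ p := by simpa using hx
    rw [ih (x, q) (Prod.mk_lt_mk_iff_left.2 hx.lt), rk_cov hρ hx]; simp
  have e2 : ∀ y ∈ Finset.univ.filter (fun y => y ⋖ q),
      D (p, y) = D p * D y * (ρ p + (σ q - 1)).choose (ρ p) := by
    intro y hy
    have hy : y ⋖ q := by simpa using hy
    rw [ih (p, y) (Prod.mk_lt_mk_iff_right.2 hy.lt), rk_cov hσ hy]; simp
  rw [D_rec hz, sum_cov, Finset.sum_congr rfl e1, Finset.sum_congr rfl e2]
  simp only [← Finset.sum_mul, ← Finset.mul_sum]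
  by_cases hp : IsMin p
  · have hq : ¬ IsMin q := fun h => hz ((isMin_prod p q).2 ⟨hp, h⟩)
    rw [← D_rec hq, rk_min hρ hp]
    have : Finset.univ.filter (fun x => x ⋖ p) = ∅ := by
      ext x; simp; exact fun h => hp.not_lt h.lt
    rw [this]; simp
  · rw [← D_rec hp]
    have hpp : 0 < ρ p := by
      obtain ⟨x, hx⟩ := not_isMin_iff.1 hp
      obtain ⟨y, -, hy⟩ := exists_le_covBy_of_lt hx
      have := rk_cov hρ hy; omega
    obtain ⟨a, ha⟩ : ∃ a, ρ p = a + 1 := ⟨ρ p - 1, by omega⟩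
    by_cases hq : IsMin q
    · rw [rk_min hσ hq]
      have : Finset.univ.filter (fun x => x ⋖ q) = ∅ := by
        ext x; simp; exact fun h => hq.not_lt h.lt
      rw [this]; simp
    · rw [← D_rec hq]
      have hqq : 0 < σ q := by
        obtain ⟨x, hx⟩ := not_isMin_iff.1 hq
        obtain ⟨y, -, hy⟩ := exists_le_covBy_of_lt hx
        have := rk_cov hσ hy; omega
      obtain ⟨b, hb⟩ : ∃ b, σ q = b + 1 := ⟨σ q - 1, by omega⟩
      rw [ha, hb, ← mul_add]
      congr 1
      rw [show a + 1 + (b + 1) = (a + b + 1) + 1 by ring, Nat.choose_succ_succ]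
      simp only [Nat.add_sub_cancel]
      rw [show a + 1 + b = a + b + 1 by ring, show a + (b + 1) = a + b + 1 by ring]

lemma U_prod {ρ : P → ℕ} {σ : Q → ℕ} (hρ : ∀ p, ∀ c ∈ MC (Set.Ici p), c.ncard = ρ p + 1)
    (hσ : ∀ p, ∀ c ∈ MC (Set.Ici p), c.ncard = σ p + 1) (p : P) (q : Q) :
    U (p, q) = U p * U q * (ρ p + σ q).choose (ρ p) := by
  have h1 : HR (α := Pᵒᵈ) ρ := fun p c hc => hρ p c (by
    rw [← MC_dual]; exact hc)
  have h2 : HR (α := Qᵒᵈ) σ := fun p c hc => hσ p c (by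
    rw [← MC_dual]; exact hc)
  have := D_prod h1 h2 (OrderDual.toDual p, OrderDual.toDual q)
  rw [U_eq p, U_eq q]
  refine Eq.trans ?_ this
  show Nat.card (MC (α := P × Q) (Set.Ici (p, q))) = _
  rw [← MC_dual]; rfl

open Classical in
lemma downDeg_eq {α : Type*} [PartialOrder α] [Fintype α] (p : α) :
    downDeg α p = ∑ x ∈ Finset.univ.filter (fun x => x ⋖ p), 1 := by
  rw [downDeg, Set.ncard_eq_toFinset_card']
  simp

lemma downDeg_prod (p : P) (q : Q) : downDeg (P × Q) (p, q) = downDeg P p + downDeg Q q := by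
  rw [downDeg_eq, downDeg_eq, downDeg_eq, sum_cov]

end prod

section sums
variable {α : Type*} [PartialOrder α] [Fintype α]

open Classical in
/-- All maximal chains. -/
noncomputable def MM (α : Type*) [PartialOrder α] [Fintype α] : Finset (Set α) :=
  Finset.univ.filter (fun c => c ∈ MC (Set.univ : Set α))

open Classical in
lemma sum_swap (g : α → ℚ) :
    ∑ c ∈ MM α, ∑ p ∈ Finset.univ.filter (fun p => p ∈ c), g p
      = ∑ p, ((D p * U p : ℕ) : ℚ) * g p := by
  simp only [Finset.sum_filter]
  rw [Finset.sum_comm]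
  refine Finset.sum_congr rfl fun p _ => ?_
  rw [← card_through, ← Finset.sum_filter, Finset.sum_const, nsmul_eq_mul, MM, Finset.filter_filter,
    Nat.card_eq_fintype_card, Fintype.card_subtype]

open Classical in
lemma EY_eq (r : ℕ) : EYgraded α r =
    (∑ p : α, ((D p * U p : ℕ) : ℚ) * downDeg α p) / (((r : ℚ) + 1) * (MM α).card) := by
  have h0 : {c : Set α | IsMaxChain (· ≤ ·) c} = (MM α : Set (Set α)) := by
    ext c; simp [MM, isMaxChain_iff]
  rw [EYgraded, h0, finsum_mem_coe_finset, Set.ncard_coe_finset, ← sum_swap]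
  congr 1
  refine Finset.sum_congr rfl fun c _ => ?_
  rw [← finsum_mem_coe_finset]
  simp

open Classical in
lemma sum_rank {r : ℕ} (h : ∀ c ∈ MC (Set.univ : Set α), c.ncard = r + 1) {ρ : α → ℕ}
    (hρ : HR ρ) (hr : ∀ p, ρ p ≤ r) (f : ℕ → ℚ) :
    ∑ p : α, ((D p * U p : ℕ) : ℚ) * f (ρ p) = (MM α).card * ∑ i ∈ Finset.range (r + 1), f i := by
  rw [← sum_swap, ← nsmul_eq_mul, ← Finset.sum_const]
  refine Finset.sum_congr rfl fun c hc => ?_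
  have hc : c ∈ MC (Set.univ : Set α) := by simpa [MM] using hc
  have hinj : Set.InjOn ρ (Finset.univ.filter (fun p => p ∈ c) : Finset α) := by
    intro x hx y hy hxy
    have hx : x ∈ c := by simpa using hx
    have hy : y ∈ c := by simpa using hy
    by_contra hne
    rcases ((hc x).1 hx).2 y hy with h' | h'
    · exact (rk_lt hρ hc hx hy (lt_of_le_of_ne h' hne)).ne hxy
    · exact (rk_lt hρ hc hy hx (lt_of_le_of_ne h' (Ne.symm hne))).ne hxy.symm
  have himg : (Finset.univ.filter (fun p => p ∈ c)).image ρ = Finset.range (r + 1) := by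
    apply Finset.eq_of_subset_of_card_le
    · intro i hi
      obtain ⟨p, -, rfl⟩ := Finset.mem_image.1 hi
      exact Finset.mem_range.2 (Nat.lt_succ_of_le (hr p))
    · rw [Finset.card_image_of_injOn hinj, Finset.card_range, ← h c hc,
        Set.ncard_eq_toFinset_card']
      apply le_of_eq; congr 1; ext; simp
  rw [← himg, Finset.sum_image hinj]

open Classical in
lemma card_MM [Nonempty α] : ((MM α).card : ℚ) = ∑ p ∈ Finset.univ.filter (fun p : α => IsMin p), (U p : ℚ) := by
  have h1 := sum_swap (α := α) (fun p => if IsMin p then 1 else 0)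
  have h2 : ∑ p : α, ((D p * U p : ℕ) : ℚ) * (if IsMin p then 1 else 0) =
      ∑ p ∈ Finset.univ.filter (fun p : α => IsMin p), (U p : ℚ) := by
    rw [Finset.sum_filter]
    refine Finset.sum_congr rfl fun p _ => ?_
    split_ifs with hp
    · simp [D_of_isMin hp]
    · simp
  rw [← h2, ← h1, Finset.card_eq_sum_ones, Nat.cast_sum]
  refine Finset.sum_congr rfl fun c hc => ?_
  have hc : c ∈ MC (Set.univ : Set α) := by simpa [MM] using hc
  have hne : c.Nonempty := ((isMaxChain_iff c).2 hc).nonempty_iff.1 inferInstance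
  obtain ⟨m, hm⟩ := (Set.toFinite c).exists_minimal hne
  have hmc : ∀ y ∈ c, m ≤ y := fun y hy => by
    rcases ((hc m).1 hm.1).2 y hy with h | h
    · exact h
    · exact hm.2 hy h
  have hmin : IsMin m := by
    intro x hx
    exact hmc x ((hc x).2 ⟨trivial, fun y hy => Or.inl (hx.trans (hmc y hy))⟩)
  rw [← Finset.sum_filter, Finset.filter_filter, Finset.sum_const]
  have : Finset.univ.filter (fun a => a ∈ c ∧ IsMin a) = {m} := by
    ext x
    simp only [Finset.mem_filter, Finset.mem_univ, true_and, Finset.mem_singleton]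
    constructor
    · rintro ⟨hx, hxm⟩; exact (hxm.eq_of_le (hmc x hx)).symm
    · rintro rfl; exact ⟨hm.1, hmin⟩
  rw [this]; simp

lemma card_MM_pos [Nonempty α] : 0 < (MM α).card := by
  obtain ⟨c, hc, -⟩ := exists_through (Classical.arbitrary α)
  exact Finset.card_pos.2 ⟨c, by simpa [MM] using hc⟩

end sums

lemma choose_id (i k n : ℕ) : ∑ j ∈ Finset.range (n + 1),
    (i + j).choose i * (k + (n - j)).choose k = (i + k + 1 + n).choose (i + k + 1) := by
  have h := congrArg (PowerSeries.coeff n) (show (PowerSeries.mk 1 : PowerSeries ℤ) ^ (i + 1) *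
    (PowerSeries.mk 1 : PowerSeries ℤ) ^ (k + 1) = (PowerSeries.mk 1 : PowerSeries ℤ) ^ (i + k + 1 + 1) by
      rw [← pow_add]; congr 1; ring)
  simp only [PowerSeries.mk_one_pow_eq_mk_choose_add, PowerSeries.coeff_mul, PowerSeries.coeff_mk] at h
  rw [Finset.Nat.sum_antidiagonal_eq_sum_range_succ
    (fun a b => (((i + a).choose i : ℕ) : ℤ) * (((k + b).choose k : ℕ) : ℤ))] at h
  exact_mod_cast h

/-- The kernel. -/
def Kf (a b i j : ℕ) : ℚ := ((i + j).choose i * ((a - i) + (b - j)).choose (a - i) : ℕ)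

lemma Kf_sum (a b i : ℕ) (hi : i ≤ a) :
    ∑ j ∈ Finset.range (b + 1), Kf a b i j = ((a + b + 1).choose (a + 1) : ℕ) := by
  simp only [Kf]
  rw [← Nat.cast_sum, choose_id, show i + (a - i) + 1 + b = a + b + 1 by omega,
    show i + (a - i) + 1 = a + 1 by omega]

lemma Kf_symm (a b i j : ℕ) : Kf a b i j = Kf b a j i := by
  simp only [Kf]
  rw [Nat.choose_symm_add, Nat.choose_symm_add, add_comm i j, add_comm (a - i)]

lemma Kf_sum' (a b j : ℕ) (hj : j ≤ b) :
    ∑ i ∈ Finset.range (a + 1), Kf a b i j = ((a + b + 1).choose (b + 1) : ℕ) := by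
  simp only [Kf_symm a b]
  rw [Kf_sum b a j hj, add_comm b a]

end MCAux

open MCAux in
theorem stmt3 (P Q : Type*) [PartialOrder P] [PartialOrder Q] [Fintype P] [Fintype Q]
    (rP rQ : ℕ)
    (hP : ∀ c : Set P, IsMaxChain (· ≤ ·) c → c.ncard = rP + 1)
    (hQ : ∀ c : Set Q, IsMaxChain (· ≤ ·) c → c.ncard = rQ + 1) :
    EYgraded (P × Q) (rP + rQ) = EYgraded P rP + EYgraded Q rQ := by
  classical
  simp only [isMaxChain_iff] at hP hQ
  have neP : Nonempty P := by
    by_contra hn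
    rw [not_nonempty_iff] at hn
    have := hP ∅ (fun x => hn.elim x)
    simp at this
  have neQ : Nonempty Q := by
    by_contra hn
    rw [not_nonempty_iff] at hn
    have := hQ ∅ (fun x => hn.elim x)
    simp at this
  obtain ⟨ρ, hρ, hρr, hρ'⟩ := exists_rank hP
  obtain ⟨σ, hσ, hσr, hσ'⟩ := exists_rank hQ
  have hN : ∀ p q, ((D (p, q) * U (p, q) : ℕ) : ℚ) =
      ((D p * U p : ℕ) : ℚ) * ((D q * U q : ℕ) : ℚ) * Kf rP rQ (ρ p) (σ q) := by
    intro p q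
    rw [D_prod hρ hσ, U_prod hρ' hσ', Kf]
    push_cast; ring
  have hM : ((MM (P × Q)).card : ℚ) = (MM P).card * (MM Q).card * ((rP + rQ).choose rP : ℕ) := by
    rw [card_MM, card_MM, card_MM, Finset.sum_mul_sum, Finset.sum_mul]
    simp only [Finset.sum_mul, ← Finset.sum_product']
    have : Finset.univ.filter (fun z : P × Q => IsMin z) =
        Finset.univ.filter (fun p : P => IsMin p) ×ˢ Finset.univ.filter (fun q : Q => IsMin q) := by
      ext ⟨p, q⟩; simp [isMin_prod]
    rw [this]
    refine Finset.sum_congr rfl ?_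
    rintro ⟨p, q⟩ hz
    obtain ⟨hp, hq⟩ : IsMin p ∧ IsMin q := by simpa using hz
    rw [U_prod hρ' hσ', rk_min hρ hp, rk_min hσ hq]
    push_cast; simp
  have hS : ∑ z : P × Q, ((D z * U z : ℕ) : ℚ) * downDeg (P × Q) z =
      (∑ p : P, ((D p * U p : ℕ) : ℚ) * downDeg P p) * ((MM Q).card *
        ((rP + rQ + 1).choose (rP + 1) : ℕ)) +
      (∑ q : Q, ((D q * U q : ℕ) : ℚ) * downDeg Q q) * ((MM P).card *
        ((rP + rQ + 1).choose (rQ + 1) : ℕ)) := by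
    have e1 : ∀ p, ∑ q : Q, ((D q * U q : ℕ) : ℚ) * Kf rP rQ (ρ p) (σ q) =
        (MM Q).card * ((rP + rQ + 1).choose (rP + 1) : ℕ) := fun p => by
      rw [sum_rank hQ hσ hσr (fun j => Kf rP rQ (ρ p) j), Kf_sum _ _ _ (hρr p)]
    have e2 : ∀ q, ∑ p : P, ((D p * U p : ℕ) : ℚ) * Kf rP rQ (ρ p) (σ q) =
        (MM P).card * ((rP + rQ + 1).choose (rQ + 1) : ℕ) := fun q => by
      rw [sum_rank hP hρ hρr (fun i => Kf rP rQ i (σ q)), Kf_sum' _ _ _ (hσr q)]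
    rw [Finset.sum_mul, Finset.sum_mul]
    simp only [Fintype.sum_prod_type, hN, downDeg_prod, Nat.cast_add, mul_add,
      Finset.sum_add_distrib]
    congr 1
    · refine Finset.sum_congr rfl fun p _ => ?_
      rw [← e1 p, Finset.mul_sum]
      exact Finset.sum_congr rfl fun q _ => by ring
    · rw [Finset.sum_comm]
      refine Finset.sum_congr rfl fun q _ => ?_
      rw [← e2 q, Finset.mul_sum]
      exact Finset.sum_congr rfl fun p _ => by ring
  rw [EY_eq, EY_eq, EY_eq, hS, hM]
  have k1 : ((rP + rQ + 1).choose (rP + 1) : ℚ) * (rP + 1) = (rP + rQ + 1) * (rP + rQ).choose rP := by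
    exact_mod_cast (Nat.add_one_mul_choose_eq (rP + rQ) rP).symm
  have k2 : ((rP + rQ + 1).choose (rQ + 1) : ℚ) * (rQ + 1) = (rP + rQ + 1) * (rP + rQ).choose rP := by
    have := (Nat.add_one_mul_choose_eq (rP + rQ) rQ).symm
    rw [← Nat.choose_symm_add] at this
    exact_mod_cast this
  have n1 : ((MM P).card : ℚ) ≠ 0 := by exact_mod_cast (card_MM_pos (α := P)).ne'
  have n2 : ((MM Q).card : ℚ) ≠ 0 := by exact_mod_cast (card_MM_pos (α := Q)).ne'
  have n3 : ((rP + rQ).choose rP : ℚ) ≠ 0 := by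
    exact_mod_cast (Nat.choose_pos (Nat.le_add_right _ _)).ne'
  have n4 : (rP : ℚ) + 1 ≠ 0 := by positivity
  have n5 : (rQ : ℚ) + 1 ≠ 0 := by positivity
  have n6 : (rP : ℚ) + rQ + 1 ≠ 0 := by positivity
  rw [← eq_div_iff n4] at k1
  rw [← eq_div_iff n5] at k2
  rw [k1, k2]
  push_cast
  field_simp
end

section
/- If P and Q are two finite graded posets that each have coincidental down-degree expectations (CDE), then P × Q is CDE. -/
open scoped BigOperators

/-- Expected down-degree under the uniform distribution. -/
noncomputable def EX (P : Type*) [PartialOrder P] : ℚ :=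
  (∑ᶠ p : P, (downDeg P p : ℚ)) / (Nat.card P : ℚ)

/-- Expected down-degree under the distribution weighting each element
proportionally to the number of maximal chains through it:
`Σ_{c ∈ M(P)} Σ_{p ∈ c} d(p) / Σ_{c ∈ M(P)} #c`. -/
noncomputable def EY (P : Type*) [PartialOrder P] : ℚ :=
  (∑ᶠ c ∈ {c : Set P | IsMaxChain (· ≤ ·) c}, ∑ᶠ p ∈ c, (downDeg P p : ℚ)) /
    (∑ᶠ c ∈ {c : Set P | IsMaxChain (· ≤ ·) c}, (c.ncard : ℚ))

/-- A poset has coincidental down-degree expectations. -/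
def IsCDE (P : Type*) [PartialOrder P] : Prop := EX P = EY P

/-- A poset is graded (of some rank `r`) if all its maximal chains have `r + 1` elements. -/
def IsGraded (P : Type*) [PartialOrder P] : Prop :=
  ∃ r : ℕ, ∀ c : Set P, IsMaxChain (· ≤ ·) c → c.ncard = r + 1

/-- maximal chains below p -/
def UU {P : Type*} [PartialOrder P] (p : P) : Set (Set P) :=
  {s | s ⊆ Set.Iic p ∧ IsChain (· ≤ ·) s ∧
    ∀ t : Set P, t ⊆ Set.Iic p → IsChain (· ≤ ·) t → s ⊆ t → t ⊆ s}

def VV {P : Type*} [PartialOrder P] (p : P) : Set (Set P) :=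
  {s | s ⊆ Set.Ici p ∧ IsChain (· ≤ ·) s ∧
    ∀ t : Set P, t ⊆ Set.Ici p → IsChain (· ≤ ·) t → s ⊆ t → t ⊆ s}

theorem chain_dual {P : Type*} [PartialOrder P] (s : Set P) :
    IsChain (α := Pᵒᵈ) (· ≤ ·) s ↔ IsChain (· ≤ ·) s :=
  ⟨fun h => h.symm, fun h => h.symm⟩

theorem VV_eq {P : Type*} [PartialOrder P] (p : P) :
    VV p = UU (P := Pᵒᵈ) (OrderDual.toDual p) := by
  ext s
  constructor
  · rintro ⟨h1, h2, h3⟩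
    exact ⟨h1, (chain_dual (P := P) s).2 h2, fun t ht hc hs => h3 t ht ((chain_dual (P := P) t).1 hc) hs⟩
  · rintro ⟨h1, h2, h3⟩
    exact ⟨h1, (chain_dual (P := P) s).1 h2, fun t ht hc hs => h3 t ht ((chain_dual (P := P) t).2 hc) hs⟩

theorem UU_mem {P : Type*} [PartialOrder P] {p : P} {s : Set P} (h : s ∈ UU p) : p ∈ s := by
  obtain ⟨h1, h2, h3⟩ := h
  refine h3 (insert p s) (Set.insert_subset (le_refl p) h1) ?_ (Set.subset_insert _ _)
    (Set.mem_insert _ _)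
  exact h2.insert fun b hb _ => Or.inr (h1 hb)

theorem VV_mem {P : Type*} [PartialOrder P] {p : P} {s : Set P} (h : s ∈ VV p) : p ∈ s := by
  rw [VV_eq] at h
  exact UU_mem (P := Pᵒᵈ) h

theorem chain_union {P : Type*} [PartialOrder P] {p : P} {s t : Set P}
    (hs : IsChain (· ≤ ·) s) (ht : IsChain (· ≤ ·) t) (h1 : s ⊆ Set.Iic p)
    (h2 : t ⊆ Set.Ici p) : IsChain (· ≤ ·) (s ∪ t) := by
  rintro x (hx | hx) y (hy | hy) hne
  · exact hs hx hy hne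
  · exact Or.inl (le_trans (h1 hx) (h2 hy))
  · exact Or.inr (le_trans (h1 hy) (h2 hx))
  · exact ht hx hy hne

theorem chain_split {P : Type*} [PartialOrder P] {p : P} {c : Set P}
    (hc : IsChain (· ≤ ·) c) (hp : p ∈ c) {x : P} (hx : x ∈ c) : x ≤ p ∨ p ≤ x :=
  hc.total hx hp

theorem union_max {P : Type*} [PartialOrder P] {p : P} {s t : Set P} (hs : s ∈ UU p)
    (ht : t ∈ VV p) : IsMaxChain (· ≤ ·) (s ∪ t) := by
  refine ⟨chain_union hs.2.1 ht.2.1 hs.1 ht.1, fun c hc hsub => ?_⟩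
  refine Set.Subset.antisymm hsub fun x hx => ?_
  have hp : p ∈ c := hsub (Or.inl (UU_mem hs))
  rcases chain_split hc hp hx with h | h
  · left
    exact hs.2.2 (c ∩ Set.Iic p) Set.inter_subset_right (hc.mono Set.inter_subset_left)
      (fun y hy => ⟨hsub (Or.inl hy), hs.1 hy⟩) ⟨hx, h⟩
  · right
    exact ht.2.2 (c ∩ Set.Ici p) Set.inter_subset_right (hc.mono Set.inter_subset_left)
      (fun y hy => ⟨hsub (Or.inr hy), ht.1 hy⟩) ⟨hx, h⟩

theorem inter_UU {P : Type*} [PartialOrder P] {p : P} {c : Set P}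
    (hc : IsMaxChain (· ≤ ·) c) (hp : p ∈ c) : c ∩ Set.Iic p ∈ UU p := by
  refine ⟨Set.inter_subset_right, hc.1.mono Set.inter_subset_left, fun t ht htc hsub x hx => ?_⟩
  have h := hc.2 (chain_union (t := c ∩ Set.Ici p) htc (hc.1.mono Set.inter_subset_left) ht
    Set.inter_subset_right) (fun y hy => by
      rcases chain_split hc.1 hp hy with h | h
      · exact Or.inl (hsub ⟨hy, h⟩)
      · exact Or.inr ⟨hy, h⟩)
  refine ⟨?_, ht hx⟩
  rw [h]
  exact Or.inl hx

theorem inter_VV {P : Type*} [PartialOrder P] {p : P} {c : Set P}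
    (hc : IsMaxChain (· ≤ ·) c) (hp : p ∈ c) : c ∩ Set.Ici p ∈ VV p := by
  rw [VV_eq]
  exact inter_UU (P := Pᵒᵈ) (p := OrderDual.toDual p)
    ⟨(chain_dual (P := P) c).2 hc.1, fun t ht hs => hc.2 ((chain_dual (P := P) t).1 ht) hs⟩ hp

theorem union_inter_Iic {P : Type*} [PartialOrder P] {p : P} {s t : Set P} (hs : s ∈ UU p)
    (ht : t ∈ VV p) : (s ∪ t) ∩ Set.Iic p = s := by
  ext x
  constructor
  · rintro ⟨h | h, h'⟩
    · exact h
    · have : x = p := le_antisymm h' (ht.1 h)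
      rw [this]; exact UU_mem hs
  · exact fun h => ⟨Or.inl h, hs.1 h⟩

theorem union_inter_Ici {P : Type*} [PartialOrder P] {p : P} {s t : Set P} (hs : s ∈ UU p)
    (ht : t ∈ VV p) : (s ∪ t) ∩ Set.Ici p = t := by
  ext x
  constructor
  · rintro ⟨h | h, h'⟩
    · have : x = p := le_antisymm (hs.1 h) h'
      rw [this]; exact VV_mem ht
    · exact h
  · exact fun h => ⟨Or.inr h, ht.1 h⟩

theorem N_eq {P : Type*} [PartialOrder P] (p : P) :
    {c : Set P | IsMaxChain (· ≤ ·) c ∧ p ∈ c}.ncard = (UU p).ncard * (VV p).ncard := by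
  rw [← Set.ncard_prod]
  have himg : {c : Set P | IsMaxChain (· ≤ ·) c ∧ p ∈ c} =
      (fun x : Set P × Set P => x.1 ∪ x.2) '' (UU p ×ˢ VV p) := by
    ext c
    constructor
    · rintro ⟨hc, hp⟩
      refine ⟨(c ∩ Set.Iic p, c ∩ Set.Ici p), ⟨inter_UU hc hp, inter_VV hc hp⟩, ?_⟩
      ext x
      constructor
      · rintro (h | h) <;> exact h.1
      · intro hx
        rcases chain_split hc.1 hp hx with h | h
        · exact Or.inl ⟨hx, h⟩
        · exact Or.inr ⟨hx, h⟩
    · rintro ⟨⟨s, t⟩, ⟨hs, ht⟩, rfl⟩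
      exact ⟨union_max hs ht, Or.inl (UU_mem hs)⟩
  rw [himg]
  refine Set.ncard_image_of_injOn ?_
  rintro ⟨s, t⟩ ⟨hs, ht⟩ ⟨s', t'⟩ ⟨hs', ht'⟩ h
  simp only at h hs ht hs' ht'
  have e1 := union_inter_Iic hs ht
  have e2 := union_inter_Ici hs ht
  rw [h] at e1 e2
  rw [union_inter_Iic hs' ht'] at e1
  rw [union_inter_Ici hs' ht'] at e2
  rw [e1, e2]

theorem UU_min {P : Type*} [PartialOrder P] {p : P} (hp : IsMin p) : UU p = {{p}} := by
  ext s
  have hI : Set.Iic p = {p} := by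
    ext x
    exact ⟨fun h => hp.eq_of_le h, fun h => le_of_eq h⟩
  constructor
  · intro h
    have h1 := h.1
    rw [hI] at h1
    exact Set.Subset.antisymm h1 (Set.singleton_subset_iff.2 (UU_mem h))
  · rintro rfl
    exact ⟨by rw [hI], Set.subsingleton_singleton.isChain, fun t ht _ _ => by rwa [hI] at ht⟩

theorem UU_insert {P : Type*} [PartialOrder P] {p q : P} (hq : q ⋖ p) {s : Set P}
    (hs : s ∈ UU q) : insert p s ∈ UU p := by
  refine ⟨Set.insert_subset le_rfl fun x hx => le_trans (hs.1 hx) hq.le, ?_, ?_⟩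
  · exact hs.2.1.insert fun b hb _ => Or.inr (le_trans (hs.1 hb) hq.le)
  · intro t ht hc hsub x hx
    by_cases hxp : x = p
    · exact Or.inl hxp
    right
    have hxlt : x < p := lt_of_le_of_ne (ht hx) hxp
    have hqt : q ∈ t := hsub (Or.inr (UU_mem hs))
    have hxq : x ≤ q := by
      rcases hc.total hx hqt with h | h
      · exact h
      · by_contra hne
        exact hq.2 (lt_of_le_not_ge h hne) hxlt
    exact hs.2.2 (t ∩ Set.Iic q) Set.inter_subset_right (hc.mono Set.inter_subset_left)
      (fun y hy => ⟨hsub (Or.inr hy), hs.1 hy⟩) ⟨hx, hxq⟩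

theorem UU_notmem {P : Type*} [PartialOrder P] {p q : P} (hq : q ⋖ p) {s : Set P}
    (hs : s ∈ UU q) : p ∉ s := fun h => absurd (hs.1 h) (not_le_of_gt hq.1)

theorem UU_decomp {P : Type*} [PartialOrder P] [Finite P] {p : P} (hp : ¬ IsMin p) {s : Set P}
    (hs : s ∈ UU p) : ∃ q, q ⋖ p ∧ ∃ t ∈ UU q, insert p t = s := by
  have hps := UU_mem hs
  have hne : (s \ {p}).Nonempty := by
    by_contra hemp
    rw [Set.not_nonempty_iff_eq_empty, Set.sdiff_eq_empty] at hemp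
    obtain ⟨q, hq⟩ := not_isMin_iff.1 hp
    have := hs.2.2 {q, p} (by
      rintro x (rfl | rfl)
      · exact hq.le
      · exact le_rfl) (IsChain.pair hq.le) (fun x hx => Or.inr (hemp hx)) (Or.inl rfl)
    exact hq.ne (hemp this)
  obtain ⟨q, hqm⟩ := (Set.toFinite (s \ {p})).exists_maximal hne
  have hgr : ∀ x ∈ s \ {p}, x ≤ q := by
    intro x hx
    rcases hs.2.1.total hx.1 hqm.1.1 with h | h
    · exact h
    · exact hqm.2 hx h
  have hqp : q < p := lt_of_le_of_ne (hs.1 hqm.1.1) hqm.1.2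
  have hcov : q ⋖ p := by
    refine ⟨hqp, fun r hr hrp => ?_⟩
    have hrs : r ∈ s := hs.2.2 (insert r s) (Set.insert_subset hrp.le hs.1)
      (hs.2.1.insert fun b hb _ => by
        by_cases hb' : b = p
        · left; rw [hb']; exact hrp.le
        · right; exact (hgr b ⟨hb, hb'⟩).trans hr.le) (Set.subset_insert _ _) (Or.inl rfl)
    exact absurd (hgr r ⟨hrs, hrp.ne⟩) (not_le_of_gt hr)
  refine ⟨q, hcov, s \ {p}, ⟨hgr, hs.2.1.mono Set.sdiff_subset, fun t ht hc hsub x hx => ?_⟩, ?_⟩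
  · refine ⟨hs.2.2 (insert p t) ?_ ?_ ?_ (Or.inr hx), ?_⟩
    · exact Set.insert_subset le_rfl fun y hy => (ht hy).trans hqp.le
    · exact hc.insert fun b hb _ => Or.inr ((ht hb).trans hqp.le)
    · intro y hy
      by_cases h : y = p
      · exact Or.inl h
      · exact Or.inr (hsub ⟨hy, h⟩)
    · rintro rfl
      exact absurd (ht hx) (not_le_of_gt hqp)
  · rw [Set.insert_sdiff_singleton, Set.insert_eq_of_mem hps]

open scoped Classical in
theorem UU_rec {P : Type*} [PartialOrder P] [Fintype P] {p : P} (hp : ¬ IsMin p) :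
    (UU p).ncard = ∑ q : P, if q ⋖ p then (UU q).ncard else 0 := by
  have : UU p = ⋃ q ∈ (Finset.univ.filter (fun q : P => q ⋖ p)), (insert p) '' UU q := by
    ext s
    simp only [Set.mem_iUnion, Finset.mem_filter, Finset.mem_univ, true_and]
    constructor
    · intro hs
      obtain ⟨q, hq, t, ht, rfl⟩ := UU_decomp hp hs
      exact ⟨q, hq, t, ht, rfl⟩
    · rintro ⟨q, hq, t, ht, rfl⟩
      exact UU_insert hq ht
  rw [← Finset.sum_filter, this]
  have hinj : ∀ q q' s s', q ⋖ p → q' ⋖ p → s ∈ UU q → s' ∈ UU q' →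
      insert p s = insert p s' → s = s' := by
    intro q q' s s' hq hq' hs hs' h
    have h1 := UU_notmem hq hs
    have h2 := UU_notmem hq' hs'
    rw [← Set.insert_sdiff_self_of_notMem h1, h, Set.insert_sdiff_self_of_notMem h2]
  have key := Set.Finite.ncard_biUnion
    (t := ((Finset.univ.filter (fun q : P => q ⋖ p) : Finset P) : Set P))
    (Set.toFinite _) (s := fun q => (insert p) '' UU q) (fun _ _ => Set.toFinite _) ?_
  · simp only [Finset.mem_coe] at key
    rw [key, finsum_mem_finset_eq_sum]
    refine Finset.sum_congr rfl fun q hq => ?_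
    have hq' : q ⋖ p := (Finset.mem_filter.1 hq).2
    exact Set.ncard_image_of_injOn fun s hs s' hs' h => hinj q q s s' hq' hq' hs hs' h
  · intro q hq q' hq' hne
    have hq1 : q ⋖ p := (Finset.mem_filter.1 hq).2
    have hq1' : q' ⋖ p := (Finset.mem_filter.1 hq').2
    refine Set.disjoint_left.2 ?_
    rintro _ ⟨s, hs, rfl⟩ ⟨s', hs', h⟩
    have := hinj _ _ _ _ hq1' hq1 hs' hs h
    subst this
    exact hne (le_antisymm (hs'.1 (UU_mem hs)) (hs.1 (UU_mem hs')))

theorem exists_max {P : Type*} [PartialOrder P] (p : P) :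
    ∃ c : Set P, IsMaxChain (· ≤ ·) c ∧ p ∈ c := by
  obtain ⟨s, hs⟩ := (Set.subsingleton_singleton (a := p)).isChain.exists_subset_flag
    (α := P)
  exact ⟨s, s.maxChain, hs rfl⟩

theorem UU_nonempty {P : Type*} [PartialOrder P] (p : P) : (UU p).Nonempty := by
  obtain ⟨c, hc, hp⟩ := exists_max p
  exact ⟨_, inter_UU hc hp⟩

theorem VV_nonempty {P : Type*} [PartialOrder P] (p : P) : (VV p).Nonempty := by
  obtain ⟨c, hc, hp⟩ := exists_max p
  exact ⟨_, inter_VV hc hp⟩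

theorem rank_cov {P : Type*} [PartialOrder P] [Finite P] {ρ : P → ℕ}
    (hρ : ∀ p, ∀ s ∈ UU p, s.ncard = ρ p + 1) {p q : P} (h : q ⋖ p) : ρ p = ρ q + 1 := by
  obtain ⟨s, hs⟩ := UU_nonempty q
  have h1 := hρ q s hs
  have h2 := hρ p _ (UU_insert h hs)
  rw [Set.ncard_insert_of_notMem (UU_notmem h hs)] at h2
  omega

theorem rank_min {P : Type*} [PartialOrder P] {ρ : P → ℕ}
    (hρ : ∀ p, ∀ s ∈ UU p, s.ncard = ρ p + 1) {p : P} (h : IsMin p) : ρ p = 0 := by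
  have := hρ p {p} (by rw [UU_min h]; rfl)
  simpa using this

open scoped Classical in
theorem sum_cov_prod {P Q : Type*} [PartialOrder P] [PartialOrder Q] [Fintype P] [Fintype Q]
    (f : P × Q → ℕ) (p : P) (q : Q) :
    (∑ x : P × Q, if x ⋖ (p, q) then f x else 0) =
      (∑ p' : P, if p' ⋖ p then f (p', q) else 0) +
        ∑ q' : Q, if q' ⋖ q then f (p, q') else 0 := by
  have h : ∀ x : P × Q, (if x ⋖ (p, q) then f x else 0) =
      (if x.2 = q then (if x.1 ⋖ p then f (x.1, q) else 0) else 0) +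
      (if x.1 = p then (if x.2 ⋖ q then f (p, x.2) else 0) else 0) := by
    rintro ⟨x, y⟩
    rw [Prod.mk_covBy_mk_iff]
    by_cases h1 : y = q
    · by_cases h2 : x = p
      · simp [h1, h2]
      · simp [h1, h2]
    · by_cases h2 : x = p
      · simp [h1, h2]
      · simp [h1, h2]
  simp only [h, Finset.sum_add_distrib]
  congr 1
  · rw [Fintype.sum_prod_type]
    simp
  · rw [Fintype.sum_prod_type_right]
    simp

open scoped Classical in
theorem not_min_sum {P : Type*} [PartialOrder P] [Fintype P] {p : P} (hp : IsMin p) (f : P → ℕ) :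
    (∑ q : P, if q ⋖ p then f q else 0) = 0 :=
  Finset.sum_eq_zero fun q _ => if_neg fun h => hp.not_lt h.1

open scoped Classical in
theorem UU_prod {P Q : Type*} [PartialOrder P] [PartialOrder Q] [Fintype P] [Fintype Q]
    {ρ : P → ℕ} {σ : Q → ℕ} (hρ : ∀ p, ∀ s ∈ UU p, s.ncard = ρ p + 1)
    (hσ : ∀ q, ∀ s ∈ UU q, s.ncard = σ q + 1) (x : P × Q) :
    (UU x).ncard = (ρ x.1 + σ x.2).choose (ρ x.1) * ((UU x.1).ncard * (UU x.2).ncard) := by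
  induction x using WellFoundedLT.induction with
  | ind x ih =>
  obtain ⟨p, q⟩ := x
  simp only
  by_cases hp : IsMin p
  · by_cases hq : IsMin q
    · rw [UU_min (Prod.isMin_iff.2 ⟨hp, hq⟩), UU_min hp, UU_min hq, rank_min hρ hp,
        rank_min hσ hq]
      simp
    · rw [UU_rec (fun h => hq (Prod.isMin_iff.1 h).2), sum_cov_prod, not_min_sum hp,
        UU_rec hq, rank_min hρ hp, UU_min hp]
      simp only [zero_add, Nat.choose_zero_right, Set.ncard_singleton, one_mul]
      refine Finset.sum_congr rfl fun q' _ => ?_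
      split_ifs with h
      · rw [ih (p, q') (Prod.mk_lt_mk_iff_right.2 h.1)]
        simp [rank_min hρ hp, UU_min hp]
      · rfl
  · by_cases hq : IsMin q
    · rw [UU_rec (fun h => hp (Prod.isMin_iff.1 h).1), sum_cov_prod, not_min_sum hq,
        UU_rec hp, rank_min hσ hq, UU_min hq]
      simp only [add_zero, Nat.choose_self, Set.ncard_singleton, one_mul, mul_one]
      refine Finset.sum_congr rfl fun p' _ => ?_
      split_ifs with h
      · rw [ih (p', q) (Prod.mk_lt_mk_iff_left.2 h.1)]
        simp [rank_min hσ hq, UU_min hq]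
      · rfl
    · obtain ⟨i, hi⟩ : ∃ i, ρ p = i + 1 := by
        obtain ⟨s, hs⟩ := UU_nonempty p
        obtain ⟨p', h, -⟩ := UU_decomp hp hs
        exact ⟨_, rank_cov hρ h⟩
      obtain ⟨j, hj⟩ : ∃ j, σ q = j + 1 := by
        obtain ⟨s, hs⟩ := UU_nonempty q
        obtain ⟨q', h, -⟩ := UU_decomp hq hs
        exact ⟨_, rank_cov hσ h⟩
      have e1 : (∑ p' : P, if p' ⋖ p then (UU (p', q)).ncard else 0) =
          (i + (j + 1)).choose i * ((UU p).ncard * (UU q).ncard) := by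
        rw [UU_rec hp, Finset.sum_mul, Finset.mul_sum]
        refine Finset.sum_congr rfl fun p' _ => ?_
        split_ifs with h
        · rw [ih (p', q) (Prod.mk_lt_mk_iff_left.2 h.1)]
          have := rank_cov hρ h
          have h' : ρ p' = i := by omega
          simp only [h', hj]
        · simp
      have e2 : (∑ q' : Q, if q' ⋖ q then (UU (p, q')).ncard else 0) =
          (i + 1 + j).choose (i + 1) * ((UU p).ncard * (UU q).ncard) := by
        rw [UU_rec hq, Finset.mul_sum, Finset.mul_sum]
        refine Finset.sum_congr rfl fun q' _ => ?_
        split_ifs with h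
        · rw [ih (p, q') (Prod.mk_lt_mk_iff_right.2 h.1)]
          have := rank_cov hσ h
          have h' : σ q' = j := by omega
          simp only [h', hi]
        · simp
      rw [UU_rec (fun h => hp (Prod.isMin_iff.1 h).1), sum_cov_prod, e1, e2, ← add_mul, hi, hj]
      congr 1
      rw [show i + 1 + (j + 1) = (i + (j + 1)) + 1 by omega, Nat.choose_succ_succ,
        show i + 1 + j = i + (j + 1) by omega]

theorem VV_prod_eq {P Q : Type*} [PartialOrder P] [PartialOrder Q] (p : P) (q : Q) :
    VV (p, q) = UU (P := Pᵒᵈ × Qᵒᵈ) (OrderDual.toDual p, OrderDual.toDual q) :=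
  VV_eq (p, q)

theorem VV_prod {P Q : Type*} [PartialOrder P] [PartialOrder Q] [Fintype P] [Fintype Q]
    {ρ : P → ℕ} {σ : Q → ℕ} (hρ : ∀ p, ∀ s ∈ VV p, s.ncard = ρ p + 1)
    (hσ : ∀ q, ∀ s ∈ VV q, s.ncard = σ q + 1) (p : P) (q : Q) :
    (VV (p, q)).ncard = (ρ p + σ q).choose (ρ p) * ((VV p).ncard * (VV q).ncard) := by
  rw [VV_prod_eq, VV_eq p, VV_eq q]
  exact UU_prod (P := Pᵒᵈ) (Q := Qᵒᵈ) (ρ := ρ) (σ := σ)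
    (fun p s hs => hρ (OrderDual.ofDual p) s
      ((Set.ext_iff.1 (VV_eq (OrderDual.ofDual p)) s).2 hs))
    (fun p s hs => hσ (OrderDual.ofDual p) s
      ((Set.ext_iff.1 (VV_eq (OrderDual.ofDual p)) s).2 hs)) (p, q)

/-- number of maximal chains through p -/
noncomputable def NN {P : Type*} [PartialOrder P] (p : P) : ℕ :=
  {c : Set P | IsMaxChain (· ≤ ·) c ∧ p ∈ c}.ncard

theorem exists_rank {P : Type*} [PartialOrder P] [Finite P] {r : ℕ}
    (h : ∀ c : Set P, IsMaxChain (· ≤ ·) c → c.ncard = r + 1) :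
    ∃ ρ : P → ℕ, (∀ p, ρ p ≤ r) ∧ (∀ p, ∀ s ∈ UU p, s.ncard = ρ p + 1) ∧
      (∀ p, ∀ s ∈ VV p, s.ncard = r - ρ p + 1) := by
  have key : ∀ p : P, ∀ s ∈ UU p, ∀ t ∈ VV p, s.ncard + t.ncard = r + 2 := by
    intro p s hs t ht
    have h1 := Set.ncard_union_add_ncard_inter s t
    have h2 : s ∩ t = {p} := by
      ext x
      constructor
      · rintro ⟨h1, h2⟩
        exact le_antisymm (hs.1 h1) (ht.1 h2)
      · rintro rfl
        exact ⟨UU_mem hs, VV_mem ht⟩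
    rw [h2, Set.ncard_singleton, h _ (union_max hs ht)] at h1
    omega
  choose u hu using fun p : P => UU_nonempty p
  choose v hv using fun p : P => VV_nonempty p
  have hpos : ∀ p : P, ∀ s ∈ UU p, 0 < s.ncard := fun p s hs =>
    (Set.ncard_pos).2 ⟨p, UU_mem hs⟩
  have hpos' : ∀ p : P, ∀ s ∈ VV p, 0 < s.ncard := fun p s hs =>
    (Set.ncard_pos).2 ⟨p, VV_mem hs⟩
  refine ⟨fun p => (u p).ncard - 1, fun p => ?_, fun p s hs => ?_, fun p t ht => ?_⟩
  · have := key p _ (hu p) _ (hv p)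
    have := hpos' p _ (hv p)
    simp only; omega
  · have := key p _ (hu p) _ (hv p)
    have := key p _ hs _ (hv p)
    have := hpos p _ (hu p)
    simp only; omega
  · have := key p _ (hu p) _ ht
    have := hpos p _ (hu p)
    have := hpos' p _ ht
    simp only; omega

theorem double_count {P : Type*} [PartialOrder P] [Fintype P] (f : P → ℚ) :
    (∑ᶠ c ∈ {c : Set P | IsMaxChain (· ≤ ·) c}, ∑ᶠ p ∈ c, f p) = ∑ p : P, (NN p : ℚ) * f p := by
  classical
  simp only [finsum_eq_sum_of_fintype, finsum_eq_if, Set.mem_ofPred_eq]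
  have : ∀ p : P, (NN p : ℚ) = ∑ c : Set P, if IsMaxChain (· ≤ ·) c ∧ p ∈ c then 1 else 0 := by
    intro p
    rw [NN, Set.ncard_eq_toFinset_card', Finset.sum_boole, Set.toFinset_ofPred]
  simp only [this, Finset.sum_mul]
  rw [Finset.sum_comm]
  refine Finset.sum_congr rfl fun c _ => ?_
  by_cases h : IsMaxChain (· ≤ ·) c
  · simp [h]
  · simp [h]

theorem EY_eq {P : Type*} [PartialOrder P] [Fintype P] :
    EY P = (∑ p : P, (NN p : ℚ) * downDeg P p) / ∑ p : P, (NN p : ℚ) := by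
  have h : ∀ c : Set P, (c.ncard : ℚ) = ∑ᶠ p ∈ c, (1 : ℚ) := by
    intro c
    classical
    simp only [finsum_eq_sum_of_fintype, finsum_eq_if,
      Finset.sum_boole]
    rw [Set.ncard_eq_toFinset_card']
    congr 2
    ext; simp
  rw [EY]
  simp only [h]
  rw [double_count, double_count]
  simp

theorem rank_sum {P : Type*} [PartialOrder P] [Fintype P] {r : ℕ} {ρ : P → ℕ}
    (h : ∀ c : Set P, IsMaxChain (· ≤ ·) c → c.ncard = r + 1)
    (hr : ∀ p, ρ p ≤ r) (hρ : ∀ p, ∀ s ∈ UU p, s.ncard = ρ p + 1) (g : ℕ → ℚ) :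
    ∑ p : P, (NN p : ℚ) * g (ρ p) =
      ({c : Set P | IsMaxChain (· ≤ ·) c}.ncard : ℚ) * ∑ j ∈ Finset.range (r + 1), g j := by
  classical
  rw [← double_count]
  have hc : ∀ c ∈ {c : Set P | IsMaxChain (· ≤ ·) c}, ∑ᶠ p ∈ c, g (ρ p) =
      ∑ j ∈ Finset.range (r + 1), g j := by
    intro c hc
    have hmono : ∀ x ∈ c, ∀ y ∈ c, x < y → ρ x < ρ y := by
      intro x hx y hy hxy
      have h1 := hρ x _ (inter_UU hc hx)
      have h2 := hρ y _ (inter_UU hc hy)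
      have : (c ∩ Set.Iic x).ncard < (c ∩ Set.Iic y).ncard := by
        refine Set.ncard_lt_ncard ?_ (Set.toFinite _)
        refine ⟨fun z hz => ⟨hz.1, hz.2.trans hxy.le⟩, fun hh => ?_⟩
        exact absurd (hh ⟨hy, le_refl y⟩).2 (not_le_of_gt hxy)
      omega
    have hinj : Set.InjOn ρ c := by
      intro x hx y hy hxy
      by_contra hne
      rcases hc.1.total hx hy with hl | hl
      · exact absurd hxy (hmono x hx y hy (lt_of_le_of_ne hl hne)).ne
      · exact absurd hxy.symm (hmono y hy x hx (lt_of_le_of_ne hl (Ne.symm hne))).ne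
    have himg : c.toFinset.image ρ = Finset.range (r + 1) := by
      refine Finset.eq_of_subset_of_card_le ?_ ?_
      · intro j hj
        obtain ⟨p, -, rfl⟩ := Finset.mem_image.1 hj
        exact Finset.mem_range.2 (Nat.lt_succ_of_le (hr p))
      · rw [Finset.card_image_of_injOn (by simpa using hinj), Finset.card_range,
          ← Set.ncard_eq_toFinset_card', h c hc]
    rw [← himg, Finset.sum_image (by simpa using hinj), finsum_mem_eq_toFinset_sum]
  rw [finsum_mem_congr rfl hc, finsum_mem_eq_toFinset_sum, Finset.sum_const, nsmul_eq_mul,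
    Set.ncard_eq_toFinset_card']

theorem vander (m n b : ℕ) :
    ∑ j ∈ Finset.range (b + 1), ((m + j).choose m * (n + (b - j)).choose n : ℚ) =
      ((m + n + 1 + b).choose (m + n + 1) : ℚ) := by
  have key : (PowerSeries.invOneSubPow ℚ (m + 1)).val * (PowerSeries.invOneSubPow ℚ (n + 1)).val =
      (PowerSeries.invOneSubPow ℚ (m + n + 1 + 1)).val := by
    rw [← Units.val_mul]
    congr 1
    simp only [PowerSeries.invOneSubPow_eq_inv_one_sub_pow]
    rw [← pow_add]
    congr 1
    omega
  have := congrArg (PowerSeries.coeff b) key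
  simp only [PowerSeries.invOneSubPow_val_succ_eq_mk_add_choose, PowerSeries.coeff_mul,
    PowerSeries.coeff_mk] at this
  rw [← this, Finset.Nat.sum_antidiagonal_eq_sum_range_succ_mk]

theorem downDeg_prod {P Q : Type*} [PartialOrder P] [PartialOrder Q] [Fintype P] [Fintype Q]
    (p : P) (q : Q) : downDeg (P × Q) (p, q) = downDeg P p + downDeg Q q := by
  classical
  have h := sum_cov_prod (fun _ => 1) p q
  simp only [Finset.sum_boole, Nat.cast_id] at h
  simp only [downDeg, Set.ncard_eq_toFinset_card', Set.toFinset_ofPred]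
  convert h

/-- If `P` and `Q` are finite graded CDE posets, then `P × Q` is CDE. -/
theorem stmt4 (P Q : Type*) [PartialOrder P] [PartialOrder Q] [Fintype P] [Fintype Q]
    (hgP : IsGraded P) (hgQ : IsGraded Q) (hP : IsCDE P) (hQ : IsCDE Q) :
    IsCDE (P × Q) := by

  classical
  obtain ⟨a, ha⟩ := hgP
  obtain ⟨b, hb⟩ := hgQ
  obtain ⟨ρ, ρr, ρU, ρV⟩ := exists_rank ha
  obtain ⟨σ, σr, σU, σV⟩ := exists_rank hb
  obtain ⟨cP, hcP⟩ : ∃ c : Set P, IsMaxChain (· ≤ ·) c := ⟨_, maxChain_spec⟩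
  obtain ⟨cQ, hcQ⟩ : ∃ c : Set Q, IsMaxChain (· ≤ ·) c := ⟨_, maxChain_spec⟩
  have neP : Nonempty P := by
    have := ha cP hcP
    obtain ⟨x, -⟩ := (Set.ncard_pos (s := cP)).1 (by omega)
    exact ⟨x⟩
  have neQ : Nonempty Q := by
    have := hb cQ hcQ
    obtain ⟨x, -⟩ := (Set.ncard_pos (s := cQ)).1 (by omega)
    exact ⟨x⟩
  have hX : EX (P × Q) = EX P + EX Q := by
    simp only [EX, finsum_eq_sum_of_fintype, Nat.card_eq_fintype_card, Fintype.sum_prod_type,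
      downDeg_prod, Fintype.card_prod]
    have h1 : (Fintype.card P : ℚ) ≠ 0 := by exact_mod_cast Fintype.card_ne_zero
    have h2 : (Fintype.card Q : ℚ) ≠ 0 := by exact_mod_cast Fintype.card_ne_zero
    push_cast
    simp only [Finset.sum_add_distrib, Finset.sum_const, Finset.card_univ, nsmul_eq_mul,
      ← Finset.mul_sum]
    field_simp
  have hMP : 0 < ({c : Set P | IsMaxChain (· ≤ ·) c}.ncard : ℚ) := by
    exact_mod_cast (Set.ncard_pos).2 ⟨cP, hcP⟩
  have hMQ : 0 < ({c : Set Q | IsMaxChain (· ≤ ·) c}.ncard : ℚ) := by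
    exact_mod_cast (Set.ncard_pos).2 ⟨cQ, hcQ⟩
  have sP := rank_sum ha ρr ρU
  have sQ := rank_sum hb σr σU
  set MP : ℚ := ({c : Set P | IsMaxChain (· ≤ ·) c}.ncard : ℚ)
  set MQ : ℚ := ({c : Set Q | IsMaxChain (· ≤ ·) c}.ncard : ℚ)
  have hN : ∀ p q, (NN ((p, q) : P × Q) : ℚ) = NN p * NN q *
      ((ρ p + σ q).choose (ρ p) * (a - ρ p + (b - σ q)).choose (a - ρ p) : ℕ) := by
    intro p q
    simp only [NN, N_eq]
    rw [UU_prod ρU σU, VV_prod ρV σV]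
    push_cast
    ring
  set K : ℚ := ((a + 1 + b).choose (a + 1) : ℚ) with hK
  set L : ℚ := ((b + 1 + a).choose (b + 1) : ℚ) with hL
  have iQ : ∀ p : P, ∑ q : Q, (NN ((p, q) : P × Q) : ℚ) = NN p * (MQ * K) := by
    intro p
    have h := sQ (fun j => ((ρ p + j).choose (ρ p) * (a - ρ p + (b - j)).choose (a - ρ p) : ℚ))
    rw [vander, Nat.add_sub_cancel' (ρr p)] at h
    rw [← h, Finset.mul_sum]
    refine Finset.sum_congr rfl fun q _ => ?_
    rw [hN]; push_cast; ring
  have iP : ∀ q : Q, ∑ p : P, (NN ((p, q) : P × Q) : ℚ) = NN q * (MP * L) := by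
    intro q
    have h := sP (fun j => ((σ q + j).choose (σ q) * (b - σ q + (a - j)).choose (b - σ q) : ℚ))
    rw [vander, Nat.add_sub_cancel' (σr q)] at h
    rw [← h, Finset.mul_sum]
    refine Finset.sum_congr rfl fun p _ => ?_
    rw [hN, Nat.choose_symm_add, Nat.choose_symm_add, add_comm (ρ p), add_comm (a - ρ p)]
    push_cast; ring
  have tP : ∑ p : P, (NN p : ℚ) = MP * (a + 1) := by
    have := sP (fun _ => 1)
    simpa using this
  have tQ : ∑ q : Q, (NN q : ℚ) = MQ * (b + 1) := by
    have := sQ (fun _ => 1)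
    simpa using this
  have d1 : ∑ x : P × Q, (NN x : ℚ) = MP * (a + 1) * (MQ * K) := by
    rw [Fintype.sum_prod_type]
    simp only [iQ]
    rw [← Finset.sum_mul, tP]
  have d2 : ∑ x : P × Q, (NN x : ℚ) = MQ * (b + 1) * (MP * L) := by
    rw [Fintype.sum_prod_type_right]
    simp only [iP]
    rw [← Finset.sum_mul, tQ]
  have num : ∑ x : P × Q, (NN x : ℚ) * downDeg (P × Q) x =
      (∑ p : P, (NN p : ℚ) * downDeg P p) * (MQ * K) +
      (∑ q : Q, (NN q : ℚ) * downDeg Q q) * (MP * L) := by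
    have e : ∀ x : P × Q, (NN x : ℚ) * downDeg (P × Q) x =
        NN x * downDeg P x.1 + NN x * downDeg Q x.2 := by
      rintro ⟨p, q⟩
      rw [downDeg_prod]; push_cast; ring
    simp only [e, Finset.sum_add_distrib]
    congr 1
    · rw [Fintype.sum_prod_type]
      simp only [← Finset.sum_mul, iQ]
      rw [Finset.sum_mul]
      exact Finset.sum_congr rfl fun _ _ => by ring
    · rw [Fintype.sum_prod_type_right]
      simp only [← Finset.sum_mul, iP]
      rw [Finset.sum_mul]
      exact Finset.sum_congr rfl fun _ _ => by ring
  have hKp : 0 < K := by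
    rw [hK]; exact_mod_cast Nat.choose_pos (by omega)
  have hLp : 0 < L := by
    rw [hL]; exact_mod_cast Nat.choose_pos (by omega)
  have hY : EY (P × Q) = EY P + EY Q := by
    rw [EY_eq, EY_eq, EY_eq, num, add_div, tP, tQ]
    congr 1
    · rw [d1, mul_div_mul_right _ _ (by positivity)]
    · rw [d2, mul_div_mul_right _ _ (by positivity)]
  unfold IsCDE at *
  rw [hX, hY, hP, hQ]
end

section
/- Let λ = δ_d ∘ (b^a) be the rectangular staircase partition (each square of the staircase (d−1, d−2, …, 1) replaced by an a × b block). Then the number of standard barely set-valued tableaux of shape λ equals (|λ|+1) · ((d−1)ab/(a+b)) · f^λ, where f^λ is the number of standard Young tableaux of shape λ. -/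
/-- The rectangular staircase Young diagram `δ_d ∘ (b^a)`: row `r` (0-indexed,
for `r < a(d-1)`) has length `b·(d-1-r/a)`. -/
def rectStaircase (d a b : ℕ) : YoungDiagram where
  cells := (Finset.range (a * (d - 1)) ×ˢ Finset.range (b * (d - 1))).filter
    (fun c => c.2 < b * (d - 1 - c.1 / a))
  isLowerSet := by
    intro x y hle hx
    simp only [Finset.coe_filter, Set.mem_setOf_eq, Finset.mem_product,
      Finset.mem_range] at hx ⊢
    obtain ⟨⟨hx1, hx2⟩, hx3⟩ := hx
    refine ⟨⟨lt_of_le_of_lt hle.1 hx1, lt_of_le_of_lt hle.2 hx2⟩, ?_⟩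
    calc y.2 ≤ x.2 := hle.2
      _ < b * (d - 1 - x.1 / a) := hx3
      _ ≤ b * (d - 1 - y.1 / a) :=
        Nat.mul_le_mul_left _ (Nat.sub_le_sub_left (Nat.div_le_div_right hle.1) _)

/-- A standard Young tableau of shape `μ` (cells 0-indexed as `(row, column)`). -/
structure SYT (μ : YoungDiagram) where
  entry : ℕ × ℕ → ℕ
  outside : ∀ c : ℕ × ℕ, c ∉ μ → entry c = 0
  bijOn : Set.BijOn entry (μ.cells : Set (ℕ × ℕ)) (Set.Icc 1 μ.card)
  row_lt : ∀ i j1 j2 : ℕ, j1 < j2 → (i, j2) ∈ μ → entry (i, j1) < entry (i, j2)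
  col_lt : ∀ i1 i2 j : ℕ, i1 < i2 → (i2, j) ∈ μ → entry (i1, j) < entry (i2, j)

/-- A standard barely set-valued tableau of shape `μ`. -/
structure SBSVT (μ : YoungDiagram) where
  entry : ℕ × ℕ → Finset ℕ
  outside : ∀ c : ℕ × ℕ, c ∉ μ → entry c = ∅
  nonempty : ∀ c : ℕ × ℕ, c ∈ μ → (entry c).Nonempty
  card_le : ∀ c : ℕ × ℕ, c ∈ μ → (entry c).card ≤ 2
  unique_double : ∃! c : ℕ × ℕ, c ∈ μ ∧ (entry c).card = 2
  mem_range : ∀ c : ℕ × ℕ, c ∈ μ → entry c ⊆ Finset.Icc 1 (μ.card + 1)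
  exactly_once : ∀ k ∈ Finset.Icc 1 (μ.card + 1), ∃! c : ℕ × ℕ, c ∈ μ ∧ k ∈ entry c
  row_le : ∀ i j1 j2 : ℕ, j1 < j2 → (i, j2) ∈ μ →
    ∀ a ∈ entry (i, j1), ∀ b ∈ entry (i, j2), a ≤ b
  col_lt : ∀ i1 i2 j : ℕ, i1 < i2 → (i2, j) ∈ μ →
    ∀ a ∈ entry (i1, j), ∀ b ∈ entry (i2, j), a < b

namespace SYT
variable {μ : YoungDiagram}

theorem ext' {S T : SYT μ} (h : S.entry = T.entry) : S = T := by
  cases S; cases T; cases h; rfl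

theorem lt_of_lt (T : SYT μ) {q p : ℕ × ℕ} (hp : p ∈ μ) (hqp : q ≤ p) (hne : q ≠ p) :
    T.entry q < T.entry p := by
  obtain ⟨i, j⟩ := q
  obtain ⟨i', j'⟩ := p
  obtain ⟨h1, h2⟩ := Prod.mk_le_mk.1 hqp
  rcases h1.eq_or_lt with h1 | h1
  · subst h1
    rcases h2.eq_or_lt with h2 | h2
    · subst h2; exact absurd rfl hne
    · exact T.row_lt _ _ _ h2 hp
  · have hmid := T.col_lt i i' j' h1 hp
    rcases h2.eq_or_lt with h2 | h2
    · subst h2; exact hmid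
    · exact (T.row_lt i j j' h2 (μ.up_left_mem h1.le le_rfl hp)).trans hmid

theorem mem_Icc (T : SYT μ) {p : ℕ × ℕ} (hp : p ∈ μ) : 1 ≤ T.entry p ∧ T.entry p ≤ μ.card :=
  T.bijOn.mapsTo hp

theorem inj (T : SYT μ) {p q : ℕ × ℕ} (hp : p ∈ μ) (hq : q ∈ μ) (h : T.entry p = T.entry q) :
    p = q := T.bijOn.injOn hp hq h

instance : Finite (SYT μ) := by
  let f : SYT μ → (μ.cells → Fin (μ.card + 1)) := fun T c =>
    ⟨T.entry c.1, Nat.lt_succ_of_le (T.mem_Icc (by simpa using c.2)).2⟩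
  refine Finite.of_injective f ?_
  intro S T h
  apply ext'
  funext c
  by_cases hc : c ∈ μ
  · have := congrFun h ⟨c, by simpa using hc⟩
    simpa [f] using this
  · rw [S.outside c hc, T.outside c hc]

noncomputable instance : Fintype (SYT μ) := Fintype.ofFinite _

def Out (T : SYT μ) (k : ℕ) (p : ℕ × ℕ) : Prop :=
  p ∈ μ ∧ T.entry p ≤ k ∧ ∀ q ∈ μ, p ≤ q → q ≠ p → k < T.entry q

def In (T : SYT μ) (k : ℕ) (p : ℕ × ℕ) : Prop :=
  p ∈ μ ∧ k < T.entry p ∧ ∀ q, q ≤ p → q ≠ p → T.entry q ≤ k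

/-- Postcomposition with a map of labels. -/
def relabel (T : SYT μ) (σ : ℕ → ℕ) (h0 : σ 0 = 0)
    (hm : ∀ x, 1 ≤ x → x ≤ μ.card → 1 ≤ σ x ∧ σ x ≤ μ.card)
    (hi : ∀ x y, σ x = σ y → x = y)
    (hlt : ∀ p q, p ∈ μ → q ≤ p → q ≠ p → σ (T.entry q) < σ (T.entry p)) : SYT μ where
  entry c := σ (T.entry c)
  outside c hc := by rw [T.outside c hc, h0]
  bijOn := by
    have h1 : Set.MapsTo (fun c => σ (T.entry c)) (μ.cells : Set (ℕ × ℕ))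
        (Set.Icc 1 μ.card) := by
      intro c hc
      have := T.mem_Icc (p := c) (by simpa using hc)
      exact hm _ this.1 this.2
    have h2 : Set.InjOn (fun c => σ (T.entry c)) (μ.cells : Set (ℕ × ℕ)) := by
      intro c hc c' hc' h
      exact T.bijOn.injOn hc hc' (hi _ _ h)
    refine ⟨h1, h2, ?_⟩
    have := Finset.surjOn_of_injOn_of_card_le (s := μ.cells) (t := Finset.Icc 1 μ.card)
      (fun c => σ (T.entry c)) (by simpa using h1) h2 (by simp [YoungDiagram.card])
    simpa using this
  row_lt i j1 j2 h hm := hlt _ _ hm (Prod.mk_le_mk.2 ⟨le_rfl, h.le⟩) (by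
    intro e; rw [Prod.mk.injEq] at e; omega)
  col_lt i1 i2 j h hm := hlt _ _ hm (Prod.mk_le_mk.2 ⟨h.le, le_rfl⟩) (by
    intro e; rw [Prod.mk.injEq] at e; omega)

/-- label `m` goes down to `k+1`. -/
def dn (k m x : ℕ) : ℕ := if x = m then k + 1 else if k < x ∧ x < m then x + 1 else x
/-- label `m` goes up to `k`. -/
def up (m k x : ℕ) : ℕ := if x = m then k else if m < x ∧ x ≤ k then x - 1 else x

def moveDn (T : SYT μ) (k : ℕ) (p : ℕ × ℕ) (h : T.In k p) : SYT μ :=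
  T.relabel (dn k (T.entry p))
    (by have := h.2.1; unfold dn; split_ifs <;> omega)
    (by
      intro x h1 h2
      have := h.2.1
      have := T.mem_Icc h.1
      unfold dn; split_ifs <;> omega)
    (by
      intro x y hxy
      have := h.2.1
      unfold dn at hxy; split_ifs at hxy <;> omega)
    (by
      intro r q hr hqr hne
      have h0 := T.lt_of_lt hr hqr hne
      have hk := h.2.1
      by_cases e1 : q = p
      · subst e1
        unfold dn; split_ifs <;> omega
      · by_cases e2 : r = p
        · subst e2
          have := h.2.2 q hqr hne
          unfold dn; split_ifs <;> omega
        · have a2 : T.entry r ≠ T.entry p := fun e => e2 (T.inj hr h.1 e)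
          have a1 : T.entry q ≠ T.entry p := fun e => e1 (T.inj (by
            exact μ.isLowerSet hqr hr) h.1 e)
          unfold dn; split_ifs <;> omega)

def moveUp (T : SYT μ) (k : ℕ) (hkn : k ≤ μ.card) (p : ℕ × ℕ) (h : T.Out k p) : SYT μ :=
  T.relabel (up (T.entry p) k)
    (by have := T.mem_Icc h.1; unfold up; split_ifs <;> omega)
    (by
      intro x h1 h2
      have := h.2.1
      have := T.mem_Icc h.1
      unfold up; split_ifs <;> omega)
    (by
      intro x y hxy
      have := h.2.1
      unfold up at hxy; split_ifs at hxy <;> omega)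
    (by
      intro r q hr hqr hne
      have h0 := T.lt_of_lt hr hqr hne
      have hk := h.2.1
      by_cases e1 : q = p
      · subst e1
        have := h.2.2 r hr hqr hne.symm
        unfold up; split_ifs <;> omega
      · by_cases e2 : r = p
        · subst e2
          unfold up; split_ifs <;> omega
        · have a2 : T.entry r ≠ T.entry p := fun e => e2 (T.inj hr h.1 e)
          have a1 : T.entry q ≠ T.entry p := fun e => e1 (T.inj (by
            exact μ.isLowerSet hqr hr) h.1 e)
          unfold up; split_ifs <;> omega)

open Classical in
theorem toggle_symm (μ : YoungDiagram) (p : ℕ × ℕ) :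
    ((Finset.univ ×ˢ Finset.range (μ.card + 1) : Finset (SYT μ × ℕ)).filter
      (fun x => x.1.In x.2 p)).card =
    ((Finset.univ ×ˢ Finset.range (μ.card + 1) : Finset (SYT μ × ℕ)).filter
      (fun x => x.1.Out x.2 p)).card := by
  refine Finset.card_bij'
    (fun x hx => (x.1.moveDn x.2 p (Finset.mem_filter.1 hx).2, x.1.entry p))
    (fun x hx => (x.1.moveUp x.2 (by
      have := (Finset.mem_filter.1 hx).1
      simp at this; omega) p (Finset.mem_filter.1 hx).2, x.1.entry p - 1)) ?_ ?_ ?_ ?_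
  · rintro ⟨T, k⟩ hx
    simp only [Finset.mem_filter, Finset.mem_product, Finset.mem_univ, true_and,
      Finset.mem_range] at hx ⊢
    obtain ⟨hk, h⟩ := hx
    have hp := T.mem_Icc h.1
    have := h.2.1
    refine ⟨by omega, h.1, ?_, ?_⟩
    · simp only [moveDn, relabel, dn]
      split_ifs <;> omega
    · intro q hq hpq hne
      have := T.lt_of_lt hq hpq hne.symm
      simp only [moveDn, relabel, dn]
      split_ifs <;> omega
  · rintro ⟨T, k⟩ hx
    simp only [Finset.mem_filter, Finset.mem_product, Finset.mem_univ, true_and,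
      Finset.mem_range] at hx ⊢
    obtain ⟨hk, h⟩ := hx
    have hp := T.mem_Icc h.1
    have := h.2.1
    refine ⟨by omega, h.1, ?_, ?_⟩
    · simp only [moveUp, relabel, up]
      split_ifs <;> omega
    · intro q hqp hne
      have := T.lt_of_lt h.1 hqp hne
      simp only [moveUp, relabel, up]
      split_ifs <;> omega
  · rintro ⟨T, k⟩ hx
    simp only [Finset.mem_filter, Finset.mem_product, Finset.mem_univ, true_and,
      Finset.mem_range] at hx
    obtain ⟨hk, h⟩ := hx
    have := h.2.1
    refine Prod.ext (ext' ?_) ?_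
    · funext c
      simp only [moveUp, moveDn, relabel, up, dn]
      split_ifs <;> omega
    · simp [moveDn, relabel, dn]
  · rintro ⟨T, k⟩ hx
    simp only [Finset.mem_filter, Finset.mem_product, Finset.mem_univ, true_and,
      Finset.mem_range] at hx
    obtain ⟨hk, h⟩ := hx
    have := h.2.1
    have := T.mem_Icc h.1
    refine Prod.ext (ext' ?_) ?_
    · funext c
      simp only [moveUp, moveDn, relabel, up, dn]
      split_ifs <;> omega
    · simp [moveUp, relabel, up]

end SYT

namespace SBSVT
variable {μ : YoungDiagram}

theorem ext' {S T : SBSVT μ} (h : S.entry = T.entry) : S = T := by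
  cases S; cases T; cases h; rfl

theorem eq_of_mem (S : SBSVT μ) {x y : ℕ × ℕ} (hx : x ∈ μ) (hy : y ∈ μ) {m : ℕ}
    (h1 : m ∈ S.entry x) (h2 : m ∈ S.entry y) : x = y :=
  (S.exactly_once m (S.mem_range x hx h1)).unique ⟨hx, h1⟩ ⟨hy, h2⟩

theorem lt_of_lt (S : SBSVT μ) {q p : ℕ × ℕ} (hp : p ∈ μ) (hqp : q ≤ p) (hne : q ≠ p)
    {s t : ℕ} (hs : s ∈ S.entry q) (ht : t ∈ S.entry p) : s < t := by
  have hq : q ∈ μ := μ.isLowerSet hqp hp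
  have hst : s ≠ t := by
    rintro rfl
    exact hne (S.eq_of_mem hq hp hs ht)
  refine lt_of_le_of_ne ?_ hst
  obtain ⟨i, j⟩ := q
  obtain ⟨i', j'⟩ := p
  obtain ⟨h1, h2⟩ := Prod.mk_le_mk.1 hqp
  rcases h1.eq_or_lt with h1 | h1
  · subst h1
    rcases h2.eq_or_lt with h2 | h2
    · subst h2; exact absurd rfl hne
    · exact S.row_le _ _ _ h2 hp _ hs _ ht
  · rcases h2.eq_or_lt with h2 | h2
    · subst h2; exact (S.col_lt i i' j h1 hp _ hs _ ht).le
    · have hm : (i, j') ∈ μ := μ.up_left_mem h1.le le_rfl hp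
      obtain ⟨u, hu⟩ := S.nonempty _ hm
      exact (S.row_le i j j' h2 hm _ hs _ hu).trans (S.col_lt i i' j' h1 hp _ hu _ ht).le

end SBSVT

namespace SYT
variable {μ : YoungDiagram}

def ofFun (f : ℕ × ℕ → ℕ) (h0 : ∀ c, c ∉ μ → f c = 0)
    (hm : ∀ c ∈ μ, 1 ≤ f c ∧ f c ≤ μ.card)
    (hi : ∀ c ∈ μ, ∀ c' ∈ μ, f c = f c' → c = c')
    (hlt : ∀ p q, p ∈ μ → q ≤ p → q ≠ p → f q < f p) : SYT μ where
  entry := f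
  outside := h0
  bijOn := by
    have h1 : Set.MapsTo f (μ.cells : Set (ℕ × ℕ)) (Set.Icc 1 μ.card) := by
      intro c hc
      exact hm c hc
    have h2 : Set.InjOn f (μ.cells : Set (ℕ × ℕ)) := by
      intro c hc c' hc' h
      exact hi c hc c' hc' h
    refine ⟨h1, h2, ?_⟩
    have := Finset.surjOn_of_injOn_of_card_le (s := μ.cells) (t := Finset.Icc 1 μ.card)
      f (by simpa using h1) h2 (by simp [YoungDiagram.card])
    simpa using this
  row_lt i j1 j2 h hm := hlt _ _ hm (Prod.mk_le_mk.2 ⟨le_rfl, h.le⟩) (by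
    intro e; rw [Prod.mk.injEq] at e; omega)
  col_lt i1 i2 j h hm := hlt _ _ hm (Prod.mk_le_mk.2 ⟨h.le, le_rfl⟩) (by
    intro e; rw [Prod.mk.injEq] at e; omega)

def sh (k t : ℕ) : ℕ := if t ≤ k then t else t + 1

theorem sh_ne (k t : ℕ) : sh k t ≠ k + 1 := by unfold sh; split_ifs <;> omega

theorem sh_inj {k s t : ℕ} (h : sh k s = sh k t) : s = t := by
  unfold sh at h; split_ifs at h <;> omega

theorem sh_lt {k s t : ℕ} (h : s < t) : sh k s < sh k t := by
  unfold sh; split_ifs <;> omega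

open Classical in
noncomputable def gent (T : SYT μ) (k : ℕ) (c x : ℕ × ℕ) : Finset ℕ :=
  if x ∈ μ then insert (sh k (T.entry x)) (if x = c then {k + 1} else ∅) else ∅

theorem mem_gent (T : SYT μ) (k : ℕ) (c x : ℕ × ℕ) (y : ℕ) :
    y ∈ T.gent k c x ↔ x ∈ μ ∧ (y = sh k (T.entry x) ∨ (x = c ∧ y = k + 1)) := by
  unfold gent
  by_cases hx : x ∈ μ
  · by_cases hc : x = c
    · subst hc; simp [hx]
    · simp [hx, hc]
  · simp [hx]

theorem card_gent (T : SYT μ) (k : ℕ) (c x : ℕ × ℕ) (hx : x ∈ μ) :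
    (T.gent k c x).card = if x = c then 2 else 1 := by
  unfold gent
  have := sh_ne k (T.entry x)
  by_cases hc : x = c
  · subst hc
    simp only [hx, if_true]
    exact Finset.card_pair this
  · simp [hx, hc]

theorem gent_lt (T : SYT μ) {k : ℕ} {c : ℕ × ℕ} (h : T.Out k c) {q r : ℕ × ℕ} (hr : r ∈ μ)
    (hqr : q ≤ r) (hne : q ≠ r) {s t : ℕ} (hs : s ∈ T.gent k c q) (ht : t ∈ T.gent k c r) :
    s < t := by
  have h0 := T.lt_of_lt hr hqr hne
  rw [mem_gent] at hs ht
  obtain ⟨_, rfl | ⟨rfl, rfl⟩⟩ := hs <;> obtain ⟨_, rfl | ⟨rfl, rfl⟩⟩ := ht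
  · exact sh_lt h0
  · have := h.2.1
    unfold sh; split_ifs <;> omega
  · have := h.2.2 r hr hqr hne.symm
    unfold sh; split_ifs <;> omega
  · exact absurd rfl hne

noncomputable def toSB (T : SYT μ) (k : ℕ) (hk : k ≤ μ.card) (c : ℕ × ℕ) (h : T.Out k c) :
    SBSVT μ where
  entry := T.gent k c
  outside x hx := by simp [gent, hx]
  nonempty x hx := ⟨sh k (T.entry x), (T.mem_gent k c x _).2 ⟨hx, Or.inl rfl⟩⟩
  card_le x hx := by rw [card_gent _ _ _ _ hx]; split_ifs <;> omega
  unique_double := by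
    refine ⟨c, ⟨h.1, by rw [card_gent _ _ _ _ h.1]; simp⟩, ?_⟩
    rintro x ⟨hx, hc⟩
    rw [card_gent _ _ _ _ hx] at hc
    by_contra hne
    simp [hne] at hc
  mem_range x hx := by
    intro y hy
    rw [mem_gent] at hy
    have := T.mem_Icc hx
    rw [Finset.mem_Icc]
    obtain ⟨_, rfl | ⟨rfl, rfl⟩⟩ := hy
    · unfold sh; split_ifs <;> omega
    · omega
  exactly_once m hm := by
    rw [Finset.mem_Icc] at hm
    simp only [mem_gent]
    by_cases e : m = k + 1
    · subst e
      refine ⟨c, ⟨h.1, h.1, Or.inr ⟨rfl, rfl⟩⟩, ?_⟩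
      rintro x ⟨_, hx, h1 | h1⟩
      · exact absurd h1.symm (sh_ne _ _)
      · exact h1.1
    · obtain ⟨x, hx, hxm⟩ := T.bijOn.surjOn
        (show (if m ≤ k then m else m - 1) ∈ Set.Icc 1 μ.card by
          rw [Set.mem_Icc]; split_ifs <;> omega)
      have hx' : x ∈ μ := hx
      have hs : m = sh k (T.entry x) := by
        rw [hxm]; unfold sh; split_ifs <;> omega
      refine ⟨x, ⟨hx', hx', Or.inl hs⟩, ?_⟩
      rintro y ⟨_, hy, h1 | h1⟩
      · exact T.inj hy hx' (sh_inj (h1.symm.trans hs))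
      · exact absurd h1.2 e
  row_le i j1 j2 hj hm s hs t ht :=
    (T.gent_lt h hm (Prod.mk_le_mk.2 ⟨le_rfl, hj.le⟩) (by
      intro e; rw [Prod.mk.injEq] at e; omega) hs ht).le
  col_lt i1 i2 j hj hm s hs t ht :=
    T.gent_lt h hm (Prod.mk_le_mk.2 ⟨hj.le, le_rfl⟩) (by
      intro e; rw [Prod.mk.injEq] at e; omega) hs ht

theorem toSB_inj {T T' : SYT μ} {k k' : ℕ} {c c' : ℕ × ℕ} (h : T.Out k c) (h' : T'.Out k' c')
    (e : T.gent k c = T'.gent k' c') : T = T' ∧ k = k' ∧ c = c' := by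
  have hc : c = c' := by
    have h1 := T.card_gent k c c h.1
    rw [e, card_gent _ _ _ _ h.1] at h1
    by_contra hne
    simp [hne] at h1
  subst hc
  have hk : k = k' := by
    have h1 : k + 1 ∈ T.gent k c c := (T.mem_gent k c c _).2 ⟨h.1, Or.inr ⟨rfl, rfl⟩⟩
    have h2 : k' + 1 ∈ T'.gent k' c c := (T'.mem_gent k' c c _).2 ⟨h.1, Or.inr ⟨rfl, rfl⟩⟩
    rw [e, mem_gent] at h1
    rw [← e, mem_gent] at h2
    have h3 := h.2.1
    have h4 := h'.2.1
    simp only [sh, h3, h4, if_true, true_and] at h1 h2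
    omega
  subst hk
  refine ⟨ext' ?_, rfl, rfl⟩
  funext x
  by_cases hx : x ∈ μ
  · have h1 : sh k (T.entry x) ∈ T.gent k c x := (T.mem_gent k c x _).2 ⟨hx, Or.inl rfl⟩
    rw [e, mem_gent] at h1
    rcases h1.2 with h1 | h1
    · exact sh_inj h1
    · exact absurd h1.2 (sh_ne _ _)
  · rw [T.outside x hx, T'.outside x hx]

theorem toSB_surj (S : SBSVT μ) : ∃ (T : SYT μ) (k : ℕ) (c : ℕ × ℕ), k ≤ μ.card ∧
    T.Out k c ∧ T.gent k c = S.entry := by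
  classical
  obtain ⟨c, ⟨hc, hc2⟩, hcu⟩ := S.unique_double
  obtain ⟨p, q, hpq, hcpq⟩ : ∃ p q, p < q ∧ S.entry c = {p, q} := by
    obtain ⟨p, q, hne, h⟩ := Finset.card_eq_two.1 hc2
    rcases lt_or_gt_of_ne hne with hl | hl
    · exact ⟨p, q, hl, h⟩
    · exact ⟨q, p, hl, by rw [h, Finset.pair_comm]⟩
  have hex : ∀ x, ∃ v, x ∈ μ → S.entry x = insert v (if x = c then {q} else ∅) ∧ v ≠ q := by
    intro x
    by_cases hx : x ∈ μ
    · by_cases hxc : x = c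
      · subst hxc
        exact ⟨p, fun _ => ⟨by simp [hcpq], hpq.ne⟩⟩
      · have h1 : (S.entry x).card ≠ 2 := fun h => hxc (hcu x ⟨hx, h⟩)
        have h2 := S.card_le x hx
        have h3 := (S.nonempty x hx).card_pos
        obtain ⟨v, hv⟩ := Finset.card_eq_one.1 (show (S.entry x).card = 1 by omega)
        refine ⟨v, fun _ => ⟨by simp [hv, hxc], ?_⟩⟩
        rintro rfl
        exact hxc (S.eq_of_mem hx hc (m := v) (by simp [hv]) (by simp [hcpq]))
    · exact ⟨0, fun h => absurd h hx⟩
  choose e he using hex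
  have hmem : ∀ x ∈ μ, e x ∈ S.entry x := fun x hx => by rw [(he x hx).1]; simp
  have hb : ∀ x ∈ μ, 1 ≤ e x ∧ e x ≤ μ.card + 1 := fun x hx => by
    have := S.mem_range x hx (hmem x hx)
    rwa [Finset.mem_Icc] at this
  have hqc : q ∈ S.entry c := by simp [hcpq]
  have hqb : 1 ≤ q ∧ q ≤ μ.card + 1 := by
    have := S.mem_range c hc hqc
    rwa [Finset.mem_Icc] at this
  have hel : e c < q := by
    have h1 := hmem c hc
    have h2 := (he c hc).2
    simp [hcpq] at h1
    omega
  let f : ℕ × ℕ → ℕ := fun x => if x ∈ μ then (if e x < q then e x else e x - 1) else 0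
  have hf : ∀ x ∈ μ, f x = if e x < q then e x else e x - 1 := fun x hx => by simp [f, hx]
  let T : SYT μ := ofFun f (fun x hx => by simp [f, hx])
    (by
      intro x hx
      have h1 := hb x hx
      have h2 := (he x hx).2
      rw [hf x hx]; split_ifs <;> omega)
    (by
      intro x hx y hy hxy
      have h2 := (he x hx).2
      have h3 := (he y hy).2
      have : e x = e y := by
        rw [hf x hx, hf y hy] at hxy; split_ifs at hxy <;> omega
      exact S.eq_of_mem hx hy (hmem x hx) (this ▸ hmem y hy))
    (by
      intro x y hx hyx hne
      have hy : y ∈ μ := μ.isLowerSet hyx hx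
      have h1 := S.lt_of_lt hx hyx hne (hmem y hy) (hmem x hx)
      have h2 := (he x hx).2
      have h3 := (he y hy).2
      rw [hf x hx, hf y hy]; split_ifs <;> omega)
  have hT : ∀ x ∈ μ, T.entry x = if e x < q then e x else e x - 1 := hf
  refine ⟨T, q - 1, c, by omega, ⟨hc, ?_, ?_⟩, ?_⟩
  · rw [hT c hc]; split_ifs <;> omega
  · intro r hr hcr hne
    have h1 := S.lt_of_lt hr hcr hne.symm hqc (hmem r hr)
    rw [hT r hr]; split_ifs <;> omega
  · funext x
    by_cases hx : x ∈ μ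
    · rw [(he x hx).1]
      have h2 := (he x hx).2
      have h3 : sh (q - 1) (T.entry x) = e x := by
        rw [hT x hx]; unfold sh; split_ifs <;> omega
      have h4 : q - 1 + 1 = q := by omega
      simp only [gent, hx, if_true, h3, h4]
    · simp [gent, hx, S.outside x hx]

open Classical in
theorem card_SBSVT (μ : YoungDiagram) : Nat.card (SBSVT μ) =
    ((Finset.univ ×ˢ Finset.range (μ.card + 1) ×ˢ μ.cells :
      Finset (SYT μ × ℕ × (ℕ × ℕ))).filter (fun x => x.1.Out x.2.1 x.2.2)).card := by
  rw [← Fintype.card_coe, ← Nat.card_eq_fintype_card]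
  symm
  have key : ∀ x : ((Finset.univ ×ˢ Finset.range (μ.card + 1) ×ˢ μ.cells :
      Finset (SYT μ × ℕ × (ℕ × ℕ))).filter (fun x => x.1.Out x.2.1 x.2.2)),
      x.1.2.1 ≤ μ.card ∧ x.1.1.Out x.1.2.1 x.1.2.2 := by
    rintro ⟨⟨T, k, c⟩, hx⟩
    simp only [Finset.mem_filter, Finset.mem_product, Finset.mem_range] at hx
    exact ⟨Nat.lt_succ_iff.1 hx.1.2.1, hx.2⟩
  refine Nat.card_eq_of_bijective
    (fun x => x.1.1.toSB x.1.2.1 (key x).1 x.1.2.2 (key x).2) ⟨?_, ?_⟩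
  · intro x y hxy
    obtain ⟨h1, h2, h3⟩ := toSB_inj (key x).2 (key y).2 (congrArg SBSVT.entry hxy)
    exact Subtype.ext (Prod.ext h1 (Prod.ext h2 h3))
  · intro S
    obtain ⟨T, k, c, hk, h, e⟩ := toSB_surj S
    refine ⟨⟨(T, k, c), ?_⟩, SBSVT.ext' e⟩
    simp only [Finset.mem_filter, Finset.mem_product, Finset.mem_univ, Finset.mem_range,
      true_and]
    exact ⟨⟨by omega, h.1⟩, h⟩

end SYT

namespace SYT
variable {μ : YoungDiagram}

def sub (T : SYT μ) (k : ℕ) : YoungDiagram where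
  cells := μ.cells.filter (fun c => T.entry c ≤ k)
  isLowerSet := by
    intro x y hle hx
    simp only [Finset.coe_filter, YoungDiagram.mem_cells] at hx ⊢
    refine ⟨μ.isLowerSet hle hx.1, ?_⟩
    by_cases e : y = x
    · rw [e]; exact hx.2
    · exact (T.lt_of_lt hx.1 hle e).le.trans hx.2

theorem mem_sub (T : SYT μ) (k : ℕ) (c : ℕ × ℕ) : c ∈ T.sub k ↔ c ∈ μ ∧ T.entry c ≤ k := by
  rw [← YoungDiagram.mem_cells]
  simp [sub]

theorem lt_rowLen (T : SYT μ) (k i j : ℕ) :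
    j < (T.sub k).rowLen i ↔ (i, j) ∈ μ ∧ T.entry (i, j) ≤ k := by
  rw [← YoungDiagram.mem_iff_lt_rowLen, mem_sub]

theorem In_iff (T : SYT μ) (k i j : ℕ) : T.In k (i, j) ↔
    (i, j) ∈ μ ∧ j = (T.sub k).rowLen i ∧ (i = 0 ∨ (T.sub k).rowLen i < (T.sub k).rowLen (i - 1)) := by
  constructor
  · rintro ⟨h1, h2, h3⟩
    have hge : ¬ j < (T.sub k).rowLen i := by
      rw [lt_rowLen]; rintro ⟨_, h⟩; omega
    have hj : j = (T.sub k).rowLen i := by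
      rcases Nat.eq_zero_or_pos j with h0 | h0
      · omega
      · have : j - 1 < (T.sub k).rowLen i := by
          rw [lt_rowLen]
          refine ⟨μ.up_left_mem le_rfl (Nat.sub_le j 1) h1,
            h3 _ (Prod.mk_le_mk.2 ⟨le_rfl, Nat.sub_le j 1⟩) ?_⟩
          intro e; rw [Prod.mk.injEq] at e; omega
        omega
    refine ⟨h1, hj, ?_⟩
    rcases Nat.eq_zero_or_pos i with h0 | h0
    · exact Or.inl h0
    · right
      rw [← hj, lt_rowLen]
      refine ⟨μ.up_left_mem (Nat.sub_le i 1) le_rfl h1,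
        h3 _ (Prod.mk_le_mk.2 ⟨Nat.sub_le i 1, le_rfl⟩) ?_⟩
      intro e; rw [Prod.mk.injEq] at e; omega
  · rintro ⟨h1, h2, h3⟩
    refine ⟨h1, ?_, ?_⟩
    · have : ¬ j < (T.sub k).rowLen i := by omega
      rw [lt_rowLen] at this
      by_contra h
      exact this ⟨h1, by omega⟩
    · rintro ⟨i', j'⟩ hle hne
      obtain ⟨hi, hj⟩ := Prod.mk_le_mk.1 hle
      have : j' < (T.sub k).rowLen i' := by
        rcases hi.eq_or_lt with e | e
        · subst e
          have : j' ≠ j := fun e => hne (by rw [e])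
          omega
        · have := (T.sub k).rowLen_anti i' (i - 1) (by omega)
          omega
      exact ((T.lt_rowLen k i' j').1 this).2

theorem Out_iff (T : SYT μ) (k i j : ℕ) : T.Out k (i, j) ↔
    j + 1 = (T.sub k).rowLen i ∧ (T.sub k).rowLen (i + 1) < (T.sub k).rowLen i := by
  constructor
  · rintro ⟨h1, h2, h3⟩
    have hlt := (T.lt_rowLen k i j).2 ⟨h1, h2⟩
    have ha : ¬ j + 1 < (T.sub k).rowLen i := by
      rw [lt_rowLen]
      rintro ⟨hm, hk⟩
      have := h3 _ hm (Prod.mk_le_mk.2 ⟨le_rfl, Nat.le_succ j⟩) (by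
        intro e; rw [Prod.mk.injEq] at e; omega)
      omega
    have hb : ¬ j < (T.sub k).rowLen (i + 1) := by
      rw [lt_rowLen]
      rintro ⟨hm, hk⟩
      have := h3 _ hm (Prod.mk_le_mk.2 ⟨Nat.le_succ i, le_rfl⟩) (by
        intro e; rw [Prod.mk.injEq] at e; omega)
      omega
    omega
  · rintro ⟨h1, h2⟩
    obtain ⟨h3, h4⟩ := (T.lt_rowLen k i j).1 (by omega)
    refine ⟨h3, h4, ?_⟩
    rintro ⟨i', j'⟩ hm hle hne
    obtain ⟨hi, hj⟩ := Prod.mk_le_mk.1 hle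
    by_contra hk
    have := (T.lt_rowLen k i' j').2 ⟨hm, by omega⟩
    rcases hi.eq_or_lt with e | e
    · subst e
      have : j' ≠ j := fun e => hne (by rw [e])
      omega
    · have := (T.sub k).rowLen_anti (i + 1) i' (by omega)
      omega

end SYT

theorem mem_rect (d a b i j : ℕ) : (i, j) ∈ rectStaircase d a b ↔
    (i < a * (d - 1) ∧ j < b * (d - 1)) ∧ j < b * (d - 1 - i / a) := by
  rw [← YoungDiagram.mem_cells]
  simp [rectStaircase]

def wI (A B : ℤ) (p : ℕ × ℕ) : ℤ := A * B - A * p.2 - B * p.1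
def wO (A B : ℤ) (p : ℕ × ℕ) : ℤ := A * (p.2 + 1) + B * (p.1 + 1) - A * B

/-- outside corners carry weight zero -/
theorem corner_zero (d a b : ℕ) (ha : 0 < a) (r : ℕ → ℕ)
    (hr : ∀ i j, j < r i → (i, j) ∈ rectStaircase d a b) (i : ℕ) (hi : i < a * (d - 1) + 1)
    (h : i = 0 ∨ r i < r (i - 1)) (hn : (i, r i) ∉ rectStaircase d a b) :
    wI ((a * (d - 1) : ℕ) : ℤ) ((b * (d - 1) : ℕ) : ℤ) (i, r i) = 0 := by
  have hmem := mem_rect d a b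
  generalize d - 1 = D at *
  have hle : ∀ i, r i ≤ b * (D - i / a) := by
    intro i
    by_contra hc
    have := (hmem _ _).1 (hr i (b * (D - i / a)) (by omega))
    omega
  have hkD : i / a ≤ D := Nat.div_le_of_le_mul (by omega)
  have hreq : r i = b * (D - i / a) := by
    refine le_antisymm (hle i) ?_
    by_contra hc
    have hiD : i < a * D := by
      by_contra hi'
      have e : i = a * D := by omega
      rw [e, Nat.mul_div_cancel_left _ ha] at hc
      simp at hc
    have h2 : b * (D - i / a) ≤ b * D := Nat.mul_le_mul_left _ (Nat.sub_le _ _)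
    exact hn ((hmem _ _).2 ⟨⟨hiD, by omega⟩, by omega⟩)
  have hik : i = a * (i / a) := by
    rcases h with h | h
    · subst h; simp
    · have h1 := hle (i - 1)
      have h2 : D - i / a < D - (i - 1) / a := by
        by_contra hc
        have := Nat.mul_le_mul_left b (not_lt.1 hc)
        omega
      by_contra hc
      have h3 := Nat.mul_div_le i a
      have h4 : i / a ≤ (i - 1) / a := by
        rw [Nat.le_div_iff_mul_le ha, mul_comm]
        omega
      omega
  generalize i / a = q at *
  obtain ⟨s, rfl⟩ := Nat.exists_eq_add_of_le hkD
  rw [Nat.add_sub_cancel_left] at hreq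
  simp only [wI]
  rw [hreq, hik]
  push_cast
  ring

open Classical in
theorem det_id (d a b : ℕ) (ha : 0 < a) (T : SYT (rectStaircase d a b)) (k : ℕ) :
    (∑ p ∈ (rectStaircase d a b).cells,
      if T.In k p then wI ((a * (d - 1) : ℕ) : ℤ) ((b * (d - 1) : ℕ) : ℤ) p else 0) +
    (∑ p ∈ (rectStaircase d a b).cells,
      if T.Out k p then wO ((a * (d - 1) : ℕ) : ℤ) ((b * (d - 1) : ℕ) : ℤ) p else 0) =
    ((a * (d - 1) : ℕ) : ℤ) * ((b * (d - 1) : ℕ) : ℤ) := by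
  set r := (T.sub k).rowLen with hrdef
  have hr : ∀ i j, j < r i → (i, j) ∈ rectStaircase d a b :=
    fun i j h => ((T.lt_rowLen k i j).1 h).1
  have hz := corner_zero d a b ha r hr
  have hanti : ∀ i, r (i + 1) ≤ r i := fun i => (T.sub k).rowLen_anti i (i + 1) (Nat.le_succ i)
  have hrA : r (a * (d - 1)) = 0 := by
    by_contra h
    have := (mem_rect _ _ _ _ _).1 (hr (a * (d - 1)) 0 (by omega))
    omega
  have hlt : ∀ i, 0 < r i → i < a * (d - 1) := fun i h =>
    ((mem_rect _ _ _ _ _).1 (hr i 0 h)).1.1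
  generalize hA : a * (d - 1) = A at *
  generalize hB : b * (d - 1) = B at *
  have h1 : (∑ p ∈ (rectStaircase d a b).cells, if T.In k p then wI (A : ℤ) (B : ℤ) p else 0) =
      ∑ i ∈ Finset.range (A + 1), if i = 0 ∨ r i < r (i - 1) then wI (A : ℤ) B (i, r i) else 0 := by
    have e : ∀ i ∈ Finset.range (A + 1),
        (if i = 0 ∨ r i < r (i - 1) then wI (A : ℤ) B (i, r i) else 0) =
        if ((i, r i) ∈ rectStaircase d a b ∧ (i = 0 ∨ r i < r (i - 1)))
          then wI (A : ℤ) B (i, r i) else 0 := by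
      intro i hi
      by_cases hc : i = 0 ∨ r i < r (i - 1)
      · by_cases hm : (i, r i) ∈ rectStaircase d a b
        · simp [hc, hm]
        · simp [hc, hm, hz i (Finset.mem_range.1 hi) hc hm]
      · simp [hc]
    rw [Finset.sum_congr rfl e, ← Finset.sum_filter, ← Finset.sum_filter]
    refine Finset.sum_nbij' (fun p => p.1) (fun i => (i, r i)) ?_ ?_ ?_ ?_ ?_
    · rintro ⟨i, j⟩ h
      simp only [Finset.mem_filter, T.In_iff, ← hrdef] at h
      obtain ⟨_, hm, rfl, hc⟩ := h
      have := ((mem_rect _ _ _ _ _).1 hm).1.1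
      simp only [Finset.mem_filter, Finset.mem_range]
      exact ⟨by omega, hm, hc⟩
    · intro i h
      simp only [Finset.mem_filter] at h
      simp only [Finset.mem_filter, T.In_iff, ← hrdef, YoungDiagram.mem_cells]
      exact ⟨h.2.1, h.2.1, trivial, h.2.2⟩
    · rintro ⟨i, j⟩ h
      simp only [Finset.mem_filter, T.In_iff, ← hrdef] at h
      rw [h.2.2.1]
    · intro i _; rfl
    · rintro ⟨i, j⟩ h
      simp only [Finset.mem_filter, T.In_iff, ← hrdef] at h
      rw [h.2.2.1]
  have h2 : (∑ p ∈ (rectStaircase d a b).cells, if T.Out k p then wO (A : ℤ) (B : ℤ) p else 0) =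
      ∑ i ∈ Finset.range A, if r (i + 1) < r i then wO (A : ℤ) B (i, r i - 1) else 0 := by
    rw [← Finset.sum_filter, ← Finset.sum_filter]
    refine Finset.sum_nbij' (fun p => p.1) (fun i => (i, r i - 1)) ?_ ?_ ?_ ?_ ?_
    · rintro ⟨i, j⟩ h
      simp only [Finset.mem_filter, T.Out_iff, ← hrdef] at h
      simp only [Finset.mem_filter, Finset.mem_range]
      exact ⟨hlt i (by omega), h.2.2⟩
    · intro i h
      simp only [Finset.mem_filter] at h
      simp only [Finset.mem_filter, T.Out_iff, ← hrdef, YoungDiagram.mem_cells]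
      exact ⟨hr _ _ (by omega), by omega, h.2⟩
    · rintro ⟨i, j⟩ h
      simp only [Finset.mem_filter, T.Out_iff, ← hrdef] at h
      ext
      · rfl
      · simp only; omega
    · intro i _; rfl
    · rintro ⟨i, j⟩ h
      simp only [Finset.mem_filter, T.Out_iff, ← hrdef] at h
      have : j = r i - 1 := by omega
      rw [this]
  rw [h1, h2, Finset.sum_range_succ', add_right_comm, ← Finset.sum_add_distrib]
  have h3 : ∀ i ∈ Finset.range A,
      ((if i + 1 = 0 ∨ r (i + 1) < r (i + 1 - 1) then wI (A : ℤ) B (i + 1, r (i + 1)) else 0) +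
      if r (i + 1) < r i then wO (A : ℤ) B (i, r i - 1) else 0) =
      (-(A : ℤ) * r (i + 1)) - (-(A : ℤ) * r i) := by
    intro i _
    have := hanti i
    rcases this.eq_or_lt with e | e
    · simp [e]
    · have hc : ((r i - 1 : ℕ) : ℤ) = r i - 1 := by omega
      simp only [Nat.add_sub_cancel, e, or_true, if_true, wI, wO, hc]
      push_cast
      ring
  rw [Finset.sum_congr rfl h3, Finset.sum_range_sub (fun i => -(A : ℤ) * r i)]
  simp [hrA, wI]

open Classical in
theorem main_id_aux (μ : YoungDiagram) (A B : ℤ)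
    (hdet0 : ∀ (T : SYT μ) (k : ℕ), (∑ p ∈ μ.cells, if T.In k p then wI A B p else 0) +
      (∑ p ∈ μ.cells, if T.Out k p then wO A B p else 0) = A * B) :
    (Nat.card (SBSVT μ) : ℤ) * (A + B) = (Nat.card (SYT μ) : ℤ) * (μ.card + 1) * (A * B) := by
  set X : Finset (SYT μ × ℕ) := Finset.univ ×ˢ Finset.range (μ.card + 1) with hX
  have hdet := Finset.sum_congr (rfl : X = X)
    (fun x (_ : x ∈ X) => hdet0 x.1 x.2)
  have hXc : (X.card : ℤ) = (Nat.card (SYT μ) : ℤ) * (μ.card + 1) := by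
    rw [hX, Finset.card_product, Finset.card_range, Finset.card_univ, Nat.card_eq_fintype_card]
    push_cast
    rfl
  rw [Finset.sum_const, nsmul_eq_mul, hXc] at hdet
  rw [← hdet, Finset.sum_add_distrib, Finset.sum_comm,
    Finset.sum_comm (s := X) (f := fun x p => if x.1.Out x.2 p then wO A B p else 0),
    ← Finset.sum_add_distrib]
  have hp : ∀ p ∈ μ.cells, ((∑ x ∈ X, if x.1.In x.2 p then wI A B p else 0) +
      ∑ x ∈ X, if x.1.Out x.2 p then wO A B p else 0) =
      ((X.filter (fun x => x.1.Out x.2 p)).card : ℤ) * (A + B) := by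
    intro p _
    rw [← Finset.sum_filter, ← Finset.sum_filter, Finset.sum_const, Finset.sum_const,
      SYT.toggle_symm μ p, nsmul_eq_mul, nsmul_eq_mul, ← mul_add]
    congr 1
    unfold wI wO
    ring
  rw [Finset.sum_congr rfl hp, ← Finset.sum_mul]
  congr 1
  rw [SYT.card_SBSVT μ, Finset.card_filter]
  push_cast
  simp only [Finset.card_filter]
  push_cast
  rw [Finset.sum_comm, hX, Finset.sum_product, Finset.sum_product]
  refine Finset.sum_congr rfl fun T _ => ?_
  rw [Finset.sum_product]

theorem main_id (d a b : ℕ) (ha : 0 < a) :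
    ((Nat.card (SBSVT (rectStaircase d a b)) : ℕ) : ℤ) *
      (((a * (d - 1) : ℕ) : ℤ) + ((b * (d - 1) : ℕ) : ℤ)) =
    (Nat.card (SYT (rectStaircase d a b)) : ℤ) * ((rectStaircase d a b).card + 1) *
      (((a * (d - 1) : ℕ) : ℤ) * ((b * (d - 1) : ℕ) : ℤ)) :=
  main_id_aux _ _ _ (fun T k => by convert det_id d a b ha T k)

/-- For the rectangular staircase `λ = δ_d ∘ (b^a)`, the number of standard barely
set-valued tableaux of shape `λ` equals `(|λ|+1) · ((d-1)ab/(a+b)) · f^λ`. -/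
theorem stmt9 (d a b : ℕ) (hd : 1 ≤ d) (ha : 0 < a) (hb : 0 < b) :
    (Nat.card (SBSVT (rectStaircase d a b)) : ℚ) =
      (((rectStaircase d a b).card : ℚ) + 1) * (((d : ℚ) - 1) * a * b / (a + b)) *
        (Nat.card (SYT (rectStaircase d a b)) : ℚ) := by
  obtain ⟨D, rfl⟩ : ∃ D, d = D + 1 := ⟨d - 1, by omega⟩
  have h := main_id (D + 1) a b ha
  have ha' : (0 : ℚ) < a := by exact_mod_cast ha
  have hb' : (0 : ℚ) < b := by exact_mod_cast hb
  rcases Nat.eq_zero_or_pos D with h0 | h0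
  · subst h0
    rw [SYT.card_SBSVT]
    have : (rectStaircase (0 + 1) a b).cells = ∅ := by simp [rectStaircase]
    rw [this]
    simp
  · have hD : (0 : ℚ) < D := by exact_mod_cast h0
    have h' := congrArg (fun z : ℤ => (z : ℚ)) h
    simp only [Nat.add_sub_cancel] at h'
    push_cast at h' ⊢
    have e : ((D : ℚ) + 1 - 1) = D := by ring
    rw [e]
    field_simp
    have : (D : ℚ) ≠ 0 := hD.ne'
    apply mul_left_cancel₀ this
    linear_combination h'
end

section
/- For the rectangular staircase partition λ = δ_d ∘ (b^a), the maximal-chain-weighted expected down-degree of the interval [∅,λ] in Young's lattice equals (d−1)ab/(a+b); explicitly, f^λ(+1) / ((|λ|+1)·f^λ) = (d−1)ab/(a+b). -/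
open scoped BigOperators

namespace RS

/-- addable cell -/
def Addb (μ : YoungDiagram) (c : ℕ × ℕ) : Prop := c ∉ μ ∧ ∀ x < c, x ∈ μ

/-- removable cell -/
def Remb (μ : YoungDiagram) (c : ℕ × ℕ) : Prop := c ∈ μ ∧ ∀ x, c < x → x ∉ μ

theorem mem_of_le' {μ : YoungDiagram} {x y : ℕ × ℕ} (h : x ≤ y) (hy : y ∈ μ) : x ∈ μ :=
  μ.isLowerSet h hy

/-- remove a cell -/
def eraseC (μ : YoungDiagram) (c : ℕ × ℕ) (hc : Remb μ c) : YoungDiagram where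
  cells := μ.cells.erase c
  isLowerSet := by
    intro x y hle hx
    simp only [Finset.coe_erase, Set.mem_sdiff, Finset.mem_coe, YoungDiagram.mem_cells,
      Set.mem_singleton_iff] at hx ⊢
    refine ⟨mem_of_le' hle hx.1, ?_⟩
    rintro rfl
    exact hc.2 x (lt_of_le_of_ne hle (Ne.symm hx.2)) hx.1

theorem mem_eraseC {μ : YoungDiagram} {c x : ℕ × ℕ} (hc : Remb μ c) :
    x ∈ eraseC μ c hc ↔ x ≠ c ∧ x ∈ μ := by
  change x ∈ μ.cells.erase c ↔ _
  simp

/-- add a cell -/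
def insC (μ : YoungDiagram) (c : ℕ × ℕ) (hc : Addb μ c) : YoungDiagram where
  cells := insert c μ.cells
  isLowerSet := by
    intro x y hle hx
    simp only [Finset.coe_insert, Set.mem_insert_iff, Finset.mem_coe,
      YoungDiagram.mem_cells] at hx ⊢
    rcases hx with rfl | hx
    · rcases eq_or_lt_of_le hle with h | h
      · exact Or.inl h
      · exact Or.inr (hc.2 _ h)
    · exact Or.inr (mem_of_le' hle hx)

theorem mem_insC {μ : YoungDiagram} {c x : ℕ × ℕ} (hc : Addb μ c) :
    x ∈ insC μ c hc ↔ x = c ∨ x ∈ μ := by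
  change x ∈ insert c μ.cells ↔ _
  simp

theorem card_insC {μ : YoungDiagram} {c : ℕ × ℕ} (hc : Addb μ c) :
    (insC μ c hc).card = μ.card + 1 := by
  change (insert c μ.cells).card = _
  rw [Finset.card_insert_of_notMem (by simpa using hc.1)]

theorem le_def' {μ ν : YoungDiagram} : μ ≤ ν ↔ ∀ x, x ∈ μ → x ∈ ν := Iff.rfl

theorem card_le' {μ ν : YoungDiagram} (h : μ ≤ ν) : μ.card ≤ ν.card :=
  Finset.card_le_card (YoungDiagram.cells_subset_iff.2 h)

theorem eq_of_le_card {μ ν : YoungDiagram} (h : μ ≤ ν) (hc : ν.card ≤ μ.card) : μ = ν := by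
  have := Finset.eq_of_subset_of_card_le (YoungDiagram.cells_subset_iff.2 h) hc
  exact YoungDiagram.ext this

theorem exists_remb {q p : YoungDiagram} (h : q < p) : ∃ c, Remb p c ∧ c ∉ q := by
  have hne : (p.cells \ q.cells).Nonempty := by
    rw [Finset.sdiff_nonempty]
    intro hs
    exact h.not_ge (YoungDiagram.cells_subset_iff.1 hs)
  obtain ⟨c, hc, hmax⟩ := Finset.exists_maximal hne
  simp only [Finset.mem_sdiff, YoungDiagram.mem_cells] at hc hmax
  refine ⟨c, ⟨hc.1, fun x hx hxp => ?_⟩, hc.2⟩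
  by_cases hxq : x ∈ q
  · exact hc.2 (mem_of_le' hx.le hxq)
  · exact hx.not_ge (hmax ⟨hxp, hxq⟩ hx.le)

theorem exists_addb {q p : YoungDiagram} (h : q < p) : ∃ c, Addb q c ∧ c ∈ p := by
  have hne : (p.cells \ q.cells).Nonempty := by
    rw [Finset.sdiff_nonempty]
    intro hs
    exact h.not_ge (YoungDiagram.cells_subset_iff.1 hs)
  obtain ⟨c, hc, hmin⟩ := Finset.exists_minimal hne
  simp only [Finset.mem_sdiff, YoungDiagram.mem_cells] at hc hmin
  refine ⟨c, ⟨hc.2, fun x hx => ?_⟩, hc.1⟩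
  by_contra hxq
  exact hx.not_ge (hmin ⟨mem_of_le' hx.le hc.1, hxq⟩ hx.le)

open Classical in
/-- number of removable cells -/
noncomputable def rem (μ : YoungDiagram) : ℕ := (μ.cells.filter (Remb μ)).card

open Classical in
theorem downDeg_eq (L : YoungDiagram) (p : {μ : YoungDiagram // μ ≤ L}) :
    downDeg {μ : YoungDiagram // μ ≤ L} p = rem p.1 := by
  unfold downDeg rem
  rw [← Set.ncard_coe_finset]
  symm
  have hrem : ∀ c ∈ ((p.1.cells.filter (Remb p.1) : Finset (ℕ × ℕ)) : Set (ℕ × ℕ)), Remb p.1 c := by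
    intro c hc; simp at hc; exact hc.2
  refine Set.ncard_congr
    (fun c hc => ⟨eraseC p.1 c (hrem c hc), fun x hx => p.2 ((mem_eraseC _).1 hx).2⟩) ?_ ?_ ?_
  · intro c hc
    have hr := hrem c hc
    have hlt : (⟨eraseC p.1 c (hrem c hc), fun x hx => p.2 ((mem_eraseC _).1 hx).2⟩ :
        {μ : YoungDiagram // μ ≤ L}) < p := by
      rw [← Subtype.coe_lt_coe]
      refine lt_of_le_of_ne (fun x hx => ((mem_eraseC hr).1 hx).2) ?_
      intro h
      have h1 : c ∈ p.1 := hr.1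
      rw [← h] at h1
      exact ((mem_eraseC hr).1 h1).1 rfl
    refine ⟨hlt, ?_⟩
    intro r h1 h2
    rw [← Subtype.coe_lt_coe] at h1 h2
    simp only at h1
    by_cases hcr : c ∈ r.1
    · apply h2.not_ge
      intro x hx
      by_cases hxc : x = c
      · rw [hxc]; exact hcr
      · exact h1.le ((mem_eraseC hr).2 ⟨hxc, hx⟩)
    · apply h1.not_ge
      intro x hx
      refine (mem_eraseC hr).2 ⟨?_, h2.le hx⟩
      rintro rfl
      exact hcr hx
  · intro c c' hc hc' h
    by_contra hne
    have h1 : c ∈ eraseC p.1 c' (hrem c' hc') := (mem_eraseC _).2 ⟨hne, (hrem c hc).1⟩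
    have h2 := congrArg Subtype.val h
    simp only at h2
    rw [← h2] at h1
    exact ((mem_eraseC _).1 h1).1 rfl
  · intro q hq
    obtain ⟨c, hc, hcq⟩ := exists_remb (Subtype.coe_lt_coe.2 hq.lt)
    refine ⟨c, by simp [hc, hc.1], ?_⟩
    have hle : q ≤ ⟨eraseC p.1 c hc, fun x hx => p.2 ((mem_eraseC _).1 hx).2⟩ := by
      intro x hx
      refine (mem_eraseC hc).2 ⟨?_, hq.le hx⟩
      rintro rfl
      exact hcq hx
    rcases eq_or_lt_of_le hle with h | h
    · exact h.symm
    · exfalso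
      refine hq.2 h ?_
      rw [← Subtype.coe_lt_coe]
      refine lt_of_le_of_ne (fun x hx => ((mem_eraseC hc).1 hx).2) ?_
      intro h
      have h1 : c ∈ p.1 := hc.1
      rw [← h] at h1
      exact ((mem_eraseC hc).1 h1).1 rfl

theorem addb_iff (μ : YoungDiagram) (i j : ℕ) :
    Addb μ (i, j) ↔ (j = μ.rowLen i ∧ (i = 0 ∨ μ.rowLen i < μ.rowLen (i - 1))) := by
  unfold Addb
  constructor
  · rintro ⟨h1, h2⟩
    rw [YoungDiagram.mem_iff_lt_rowLen] at h1
    have hj : j = μ.rowLen i := by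
      rcases Nat.eq_zero_or_pos j with h | h
      · omega
      · have := h2 (i, j - 1) (by rw [Prod.lt_iff]; right; simp; omega)
        rw [YoungDiagram.mem_iff_lt_rowLen] at this
        omega
    refine ⟨hj, ?_⟩
    rcases Nat.eq_zero_or_pos i with h | h
    · exact Or.inl h
    · right
      have := h2 (i - 1, j) (by rw [Prod.lt_iff]; left; simp; omega)
      rw [YoungDiagram.mem_iff_lt_rowLen] at this
      omega
  · rintro ⟨h1, h2⟩
    refine ⟨by rw [YoungDiagram.mem_iff_lt_rowLen]; omega, ?_⟩
    rintro ⟨x, y⟩ hxy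
    rw [YoungDiagram.mem_iff_lt_rowLen]
    rw [Prod.lt_iff] at hxy
    simp only at hxy
    rcases hxy with h | h
    · have := μ.rowLen_anti x (i - 1) (by omega)
      omega
    · have := μ.rowLen_anti x i (by omega)
      omega

theorem remb_iff (μ : YoungDiagram) (i j : ℕ) :
    Remb μ (i, j) ↔ (j + 1 = μ.rowLen i ∧ μ.rowLen (i + 1) < μ.rowLen i) := by
  unfold Remb
  constructor
  · rintro ⟨h1, h2⟩
    rw [YoungDiagram.mem_iff_lt_rowLen] at h1
    have a1 := h2 (i, j + 1) (by rw [Prod.lt_iff]; right; simp)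
    have a2 := h2 (i + 1, j) (by rw [Prod.lt_iff]; left; simp)
    rw [YoungDiagram.mem_iff_lt_rowLen] at a1 a2
    omega
  · rintro ⟨h1, h2⟩
    refine ⟨by rw [YoungDiagram.mem_iff_lt_rowLen]; omega, ?_⟩
    rintro ⟨x, y⟩ hxy
    rw [YoungDiagram.mem_iff_lt_rowLen]
    rw [Prod.lt_iff] at hxy
    simp only at hxy
    rcases hxy with h | h
    · have := μ.rowLen_anti (i + 1) x (by omega)
      omega
    · have := μ.rowLen_anti i x (by omega)
      omega

theorem mem_rect (d a b i j : ℕ) (ha : 0 < a) :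
    (i, j) ∈ rectStaircase d a b ↔ j < b * (d - 1 - i / a) := by
  rw [← YoungDiagram.mem_cells]
  simp only [rectStaircase, Finset.mem_filter, Finset.mem_product, Finset.mem_range]
  constructor
  · exact fun h => h.2
  · intro h
    have h1 : 0 < d - 1 - i / a := by
      by_contra h0
      have : d - 1 - i / a = 0 := by omega
      rw [this] at h; simp at h
    refine ⟨⟨?_, lt_of_lt_of_le h (Nat.mul_le_mul_left _ (Nat.sub_le _ _))⟩, h⟩
    have : i / a < d - 1 := by omega
    rw [Nat.div_lt_iff_lt_mul ha] at this
    rwa [mul_comm]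

/-- the linear potential -/
def pot (d a b : ℕ) (c : ℕ × ℕ) : ℚ := a * b * ((d : ℚ) - 1) - a * c.2 - b * c.1

theorem pot_zero (d a b : ℕ) (hd : 1 ≤ d) (ha : 0 < a) (hb : 0 < b) (μ : YoungDiagram)
    (hμ : μ ≤ rectStaircase d a b) (c : ℕ × ℕ) (hc : Addb μ c) (hcL : c ∉ rectStaircase d a b) :
    pot d a b c = 0 := by
  obtain ⟨i, j⟩ := c
  obtain ⟨e, rfl⟩ : ∃ e, d = e + 1 := ⟨d - 1, by omega⟩
  have h2 := hc.2
  rw [mem_rect _ _ _ _ _ ha] at hcL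
  simp only [Nat.add_sub_cancel] at hcL
  have hj : j = b * (e - i / a) := by
    rcases Nat.eq_zero_or_pos j with h | h
    · omega
    · have := hμ (h2 (i, j - 1) (by rw [Prod.lt_iff]; right; simp; omega))
      rw [mem_rect _ _ _ _ _ ha] at this
      simp only [Nat.add_sub_cancel] at this
      omega
  obtain ⟨q, hi, hq⟩ : ∃ q, i = a * q ∧ q ≤ e := by
    rcases Nat.eq_zero_or_pos i with h | h
    · exact ⟨0, by simpa using h, by omega⟩
    · have := hμ (h2 (i - 1, j) (by rw [Prod.lt_iff]; left; simp; omega))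
      rw [mem_rect _ _ _ _ _ ha] at this
      simp only [Nat.add_sub_cancel] at this
      rw [hj] at this
      have h3 := Nat.lt_of_mul_lt_mul_left this
      obtain ⟨k, rfl⟩ : ∃ k, i = k + 1 := ⟨i - 1, by omega⟩
      simp only [Nat.add_sub_cancel] at h3
      rw [Nat.succ_div] at h3
      split_ifs at h3 with hdv
      · obtain ⟨q, hq⟩ := hdv
        refine ⟨q, hq, ?_⟩
        have : (k + 1) / a = q := by rw [hq]; exact Nat.mul_div_cancel_left _ ha
        rw [Nat.succ_div, if_pos ⟨q, hq⟩] at this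
        omega
      · omega
  have hdiv : i / a = q := by rw [hi]; exact Nat.mul_div_cancel_left _ ha
  rw [hdiv] at hj
  subst hi hj
  simp only [pot]
  push_cast [hq]
  ring

open Classical in
theorem key_identity (d a b : ℕ) (hd : 1 ≤ d) (ha : 0 < a) (hb : 0 < b) (μ : YoungDiagram)
    (hμ : μ ≤ rectStaircase d a b) :
    (∑ c ∈ (rectStaircase d a b).cells, if Addb μ c then pot d a b c else 0)
      - (∑ c ∈ (rectStaircase d a b).cells, if Remb μ c then pot d a b c else 0)
      + (a + b) * (rem μ : ℚ) = ((d : ℚ) - 1) * a * b := by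
  set L := rectStaircase d a b with hL
  set M := L.colLen 0 with hM
  set N := L.rowLen 0 with hN
  have hM0 : ∀ i, M ≤ i → μ.rowLen i = 0 := by
    intro i hi
    by_contra h
    have h1 : (i, 0) ∈ μ := by rw [YoungDiagram.mem_iff_lt_rowLen]; omega
    have h2 : (i, 0) ∈ L := hμ h1
    rw [YoungDiagram.mem_iff_lt_colLen] at h2
    omega
  have hN0 : ∀ i, μ.rowLen i ≤ N := by
    intro i
    by_contra h
    have h1 : (i, N) ∈ μ := by rw [YoungDiagram.mem_iff_lt_rowLen]; omega
    have h2 : (0, N) ∈ L := hμ (μ.up_left_mem (Nat.zero_le _) le_rfl h1)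
    rw [YoungDiagram.mem_iff_lt_rowLen] at h2
    omega
  have hsub : L.cells ⊆ Finset.range (M + 1) ×ˢ Finset.range (N + 1) := by
    rintro ⟨i, j⟩ h
    rw [YoungDiagram.mem_cells] at h
    have h1 : (i, 0) ∈ L := L.up_left_mem le_rfl (Nat.zero_le _) h
    have h2 : (0, j) ∈ L := L.up_left_mem (Nat.zero_le _) le_rfl h
    rw [YoungDiagram.mem_iff_lt_colLen] at h1
    rw [YoungDiagram.mem_iff_lt_rowLen] at h2
    simp; omega
  have e1 : (∑ c ∈ L.cells, if Addb μ c then pot d a b c else 0)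
      = ∑ i ∈ Finset.range (M + 1),
        if (i = 0 ∨ μ.rowLen i < μ.rowLen (i - 1)) then pot d a b (i, μ.rowLen i) else 0 := by
    rw [Finset.sum_subset hsub, Finset.sum_product]
    · refine Finset.sum_congr rfl fun i _ => ?_
      rw [Finset.sum_eq_single (μ.rowLen i)]
      · simp [addb_iff]
      · intro j _ hj
        rw [if_neg]; rw [addb_iff]; tauto
      · intro h
        exact absurd (Finset.mem_range.2 (Nat.lt_succ_of_le (hN0 i))) h
    · intro c _ hc
      split_ifs with h
      · exact pot_zero d a b hd ha hb μ hμ c h (by simpa using hc)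
      · rfl
  have hr : (rem μ : ℚ) = ∑ c ∈ L.cells, if Remb μ c then (1 : ℚ) else 0 := by
    unfold rem
    rw [Finset.sum_boole]
    congr 2
    ext c
    simp only [Finset.mem_filter, YoungDiagram.mem_cells]
    exact ⟨fun h => ⟨hμ h.1, h.2⟩, fun h => ⟨h.2.1, h.2⟩⟩
  have e2 : (∑ c ∈ L.cells, if Remb μ c then pot d a b c else 0) - (a + b) * (rem μ : ℚ)
      = ∑ i ∈ Finset.range M,
        if (μ.rowLen (i + 1) < μ.rowLen i) then pot d a b (i + 1, μ.rowLen i) else 0 := by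
    rw [hr, Finset.mul_sum, ← Finset.sum_sub_distrib, Finset.sum_subset hsub, Finset.sum_product,
      Finset.sum_range_succ]
    · rw [Finset.sum_eq_zero (s := Finset.range (N + 1)), add_zero]
      · refine Finset.sum_congr rfl fun i _ => ?_
        by_cases hlt : μ.rowLen (i + 1) < μ.rowLen i
        · rw [Finset.sum_eq_single (μ.rowLen i - 1)]
          · rw [if_pos, if_pos, if_pos hlt]
            · obtain ⟨k, hk⟩ : ∃ k, μ.rowLen i = k + 1 := ⟨μ.rowLen i - 1, by omega⟩
              rw [hk]
              simp only [pot, Nat.add_sub_cancel]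
              push_cast
              ring
            · rw [remb_iff]; omega
            · rw [remb_iff]; omega
          · intro j _ hj
            rw [if_neg, if_neg]
            · simp
            · rw [remb_iff]; omega
            · rw [remb_iff]; omega
          · intro h
            have := hN0 i
            simp at h; omega
        · rw [if_neg hlt]
          apply Finset.sum_eq_zero
          intro j _
          have : ¬ Remb μ (i, j) := by rw [remb_iff]; tauto
          simp [this]
      · intro j _
        have : ¬ Remb μ (M, j) := by
          rw [remb_iff, hM0 M le_rfl]; omega
        simp [this]
    · intro c _ hc
      have : ¬ Remb μ c := fun h => hc (by simpa using hμ h.1)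
      simp [this]
  have e3 : ∀ K, (∑ i ∈ Finset.range (K + 1),
        if (i = 0 ∨ μ.rowLen i < μ.rowLen (i - 1)) then pot d a b (i, μ.rowLen i) else 0)
      - (∑ i ∈ Finset.range K,
        if (μ.rowLen (i + 1) < μ.rowLen i) then pot d a b (i + 1, μ.rowLen i) else 0)
      = ((d : ℚ) - 1) * a * b - a * μ.rowLen K := by
    intro K
    induction K with
    | zero => simp [pot]; ring
    | succ K ih =>
      rw [Finset.sum_range_succ _ (K + 1)]
      rw [sub_eq_iff_eq_add] at ih
      rw [ih, Finset.sum_range_succ _ K]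
      have := μ.rowLen_anti K (K + 1) (by omega)
      rcases eq_or_lt_of_le this with h | h
      · simp [h]
      · simp only [Nat.add_sub_cancel, h, or_true, if_true, pot]
        push_cast
        ring
  have := e3 M
  rw [hM0 M le_rfl] at this
  simp only [Nat.cast_zero, mul_zero, sub_zero] at this
  rw [← this, ← e1, ← e2]
  ring

theorem _root_.SYT.lt_of_lt_s11 {μ : YoungDiagram} (T : SYT μ) {x y : ℕ × ℕ} (h : x < y) (hy : y ∈ μ) :
    T.entry x < T.entry y := by
  obtain ⟨i, j⟩ := x
  obtain ⟨i', j'⟩ := y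
  have hle := h.le
  rw [Prod.mk_le_mk] at hle
  have h1 : T.entry (i, j) ≤ T.entry (i, j') := by
    rcases eq_or_lt_of_le hle.2 with h2 | h2
    · rw [h2]
    · exact (T.row_lt i j j' h2 (μ.up_left_mem hle.1 le_rfl hy)).le
  have h3 : T.entry (i, j') ≤ T.entry (i', j') := by
    rcases eq_or_lt_of_le hle.1 with h2 | h2
    · rw [h2]
    · exact (T.col_lt i i' j' h2 hy).le
  refine lt_of_le_of_ne (h1.trans h3) ?_
  intro he
  have := T.bijOn.injOn (x₁ := (i, j)) (x₂ := (i', j')) (by simpa using mem_of_le' h.le hy)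
    (by simpa using hy) he
  exact h.ne this

theorem _root_.SYT.mem_range {μ : YoungDiagram} (T : SYT μ) {x : ℕ × ℕ} (hx : x ∈ μ) :
    1 ≤ T.entry x ∧ T.entry x ≤ μ.card :=
  T.bijOn.mapsTo (x := x) (by simpa using hx)

theorem _root_.SYT.inj_s11 {μ : YoungDiagram} (T : SYT μ) {x y : ℕ × ℕ} (hx : x ∈ μ) (hy : y ∈ μ)
    (h : T.entry x = T.entry y) : x = y :=
  T.bijOn.injOn (by simpa using hx) (by simpa using hy) h

theorem _root_.SYT.ext'_s11 {μ : YoungDiagram} {T S : SYT μ} (h : T.entry = S.entry) : T = S := by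
  cases T; cases S; simp_all

/-- build an SYT -/
def mkSYT (μ : YoungDiagram) (f : ℕ × ℕ → ℕ) (h0 : ∀ c, c ∉ μ → f c = 0)
    (hr : ∀ c ∈ μ, 1 ≤ f c ∧ f c ≤ μ.card) (hi : ∀ x ∈ μ, ∀ y ∈ μ, f x = f y → x = y)
    (hl : ∀ x y, x < y → y ∈ μ → f x < f y) : SYT μ where
  entry := f
  outside := h0
  bijOn := by
    have hm : Set.MapsTo f (μ.cells : Set (ℕ × ℕ)) (Finset.Icc 1 μ.card : Finset ℕ) := by
      intro x hx
      simpa using hr x (by simpa using hx)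
    have hinj : Set.InjOn f (μ.cells : Set (ℕ × ℕ)) := by
      intro x hx y hy h
      exact hi x (by simpa using hx) y (by simpa using hy) h
    refine ⟨by simpa using hm, hinj, ?_⟩
    have := Finset.surjOn_of_injOn_of_card_le (s := μ.cells) (t := Finset.Icc 1 μ.card) f hm hinj
      (by simp)
    simpa using this
  row_lt := by
    intro i j1 j2 h hm
    exact hl _ _ (by rw [Prod.lt_iff]; right; simpa using h) hm
  col_lt := by
    intro i j1 j2 h hm
    exact hl _ _ (by rw [Prod.lt_iff]; left; simpa using h) hm

/-- SYT with a missing value -/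
structure Aug (μ : YoungDiagram) where
  entry : ℕ × ℕ → ℕ
  hole : ℕ
  outside : ∀ c, c ∉ μ → entry c = 0
  hole_mem : 1 ≤ hole ∧ hole ≤ μ.card + 1
  mem : ∀ x ∈ μ, 1 ≤ entry x ∧ entry x ≤ μ.card + 1
  ne : ∀ x ∈ μ, entry x ≠ hole
  inj_s11 : ∀ x ∈ μ, ∀ y ∈ μ, entry x = entry y → x = y
  lt : ∀ x y, x < y → y ∈ μ → entry x < entry y

theorem Aug.ext'_s11 {μ : YoungDiagram} {F G : Aug μ} (h : F.entry = G.entry) (h' : F.hole = G.hole) :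
    F = G := by
  cases F; cases G; simp_all

/-- the equivalence -/
def augEquiv (μ : YoungDiagram) : Aug μ ≃ SYT μ × Fin (μ.card + 1) where
  toFun F := ⟨mkSYT μ (fun x => if F.entry x < F.hole then F.entry x else F.entry x - 1)
      (by intro c hc; simp [F.outside c hc])
      (by
        intro c hc
        have h1 := F.mem c hc
        have h2 := F.hole_mem
        have h3 := F.ne c hc
        split_ifs <;> omega)
      (by
        intro x hx y hy h
        have h1 := F.mem x hx
        have h1' := F.mem y hy
        have h2 := F.hole_mem
        have h3 := F.ne x hx
        have h3' := F.ne y hy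
        refine F.inj_s11 x hx y hy ?_
        split_ifs at h <;> omega)
      (by
        intro x y hxy hy
        have hx := mem_of_le' hxy.le hy
        have h1 := F.mem x hx
        have h1' := F.mem y hy
        have h2 := F.hole_mem
        have h3 := F.ne x hx
        have h3' := F.ne y hy
        have h4 := F.lt x y hxy hy
        split_ifs <;> omega), ⟨F.hole - 1, by have := F.hole_mem; omega⟩⟩
  invFun P :=
    { entry := fun x => if P.1.entry x ≤ P.2 then P.1.entry x else P.1.entry x + 1
      hole := P.2 + 1
      outside := by intro c hc; simp [P.1.outside c hc]
      hole_mem := by have := P.2.2; omega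
      mem := by
        intro x hx
        have := P.1.mem_range hx
        split_ifs <;> omega
      ne := by
        intro x hx
        split_ifs <;> omega
      inj_s11 := by
        intro x hx y hy h
        refine P.1.inj_s11 hx hy ?_
        split_ifs at h <;> omega
      lt := by
        intro x y hxy hy
        have := P.1.lt_of_lt_s11 hxy hy
        split_ifs <;> omega }
  left_inv F := by
    apply Aug.ext'_s11
    · funext x
      have h2 := F.hole_mem
      by_cases hx : x ∈ μ
      · have h1 := F.mem x hx
        have h3 := F.ne x hx
        simp only [mkSYT]
        split_ifs <;> omega
      · have := F.outside x hx
        simp [mkSYT, this]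
    · have h2 := F.hole_mem
      simp only
      omega
  right_inv P := by
    refine Prod.ext ?_ ?_
    · apply SYT.ext'_s11
      funext x
      simp only [mkSYT]
      split_ifs <;> omega
    · apply Fin.ext
      simp

/-- order ideal of cells with entry at most k -/
def sytIdl {μ : YoungDiagram} (T : SYT μ) (k : ℕ) : YoungDiagram where
  cells := μ.cells.filter (fun x => T.entry x ≤ k)
  isLowerSet := by
    intro x y hle hx
    simp only [Finset.coe_filter, Set.mem_ofPred_eq, YoungDiagram.mem_cells] at hx ⊢
    refine ⟨mem_of_le' hle hx.1, ?_⟩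
    rcases eq_or_lt_of_le hle with h | h
    · rw [h]; exact hx.2
    · exact (T.lt_of_lt_s11 h hx.1).le.trans hx.2

theorem mem_sytIdl {μ : YoungDiagram} (T : SYT μ) (k : ℕ) (x : ℕ × ℕ) :
    x ∈ sytIdl T k ↔ x ∈ μ ∧ T.entry x ≤ k := by
  change x ∈ μ.cells.filter (fun x => T.entry x ≤ k) ↔ _
  simp

/-- order ideal below the hole -/
def augIdl {μ : YoungDiagram} (F : Aug μ) : YoungDiagram :=
  sytIdl (augEquiv μ F).1 (augEquiv μ F).2

theorem mem_augIdl {μ : YoungDiagram} (F : Aug μ) (x : ℕ × ℕ) :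
    x ∈ augIdl F ↔ x ∈ μ ∧ F.entry x < F.hole := by
  unfold augIdl
  rw [mem_sytIdl]
  refine and_congr_right fun hx => ?_
  have h1 := F.mem x hx
  have h2 := F.hole_mem
  have h3 := F.ne x hx
  simp only [augEquiv, mkSYT, Equiv.coe_fn_mk]
  split_ifs <;> omega

theorem augIdl_le {μ : YoungDiagram} (F : Aug μ) : augIdl F ≤ μ := by
  intro x hx
  exact ((mem_augIdl F x).1 hx).1

theorem addb_aug {μ : YoungDiagram} (F : Aug μ) (c : ℕ × ℕ) (hc : c ∈ μ) :
    Addb (augIdl F) c ↔ F.hole < F.entry c ∧ ∀ x < c, F.entry x < F.hole := by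
  unfold Addb
  have h3 := F.ne c hc
  simp only [mem_augIdl, hc, true_and]
  refine and_congr (by omega) (forall₂_congr fun x hx => ?_)
  simp [mem_of_le' hx.le hc]

theorem remb_aug {μ : YoungDiagram} (F : Aug μ) (c : ℕ × ℕ) (hc : c ∈ μ) :
    Remb (augIdl F) c ↔ F.entry c < F.hole ∧ ∀ x, c < x → x ∈ μ → F.hole < F.entry x := by
  unfold Remb
  simp only [mem_augIdl, hc, true_and]
  refine and_congr_right fun _ => (forall₂_congr fun x hx => ?_)
  constructor
  · intro h hx
    have := F.ne x hx
    by_contra h'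
    exact h ⟨hx, by omega⟩
  · rintro h ⟨h1, h2⟩
    have := h h1
    omega

/-- swap the hole with the entry of `c` -/
def swapA {μ : YoungDiagram} (F : Aug μ) (c : ℕ × ℕ) (hc : c ∈ μ)
    (h1 : ∀ x < c, F.entry x < F.hole) (h2 : ∀ x, c < x → x ∈ μ → F.hole < F.entry x) : Aug μ where
  entry := Function.update F.entry c F.hole
  hole := F.entry c
  outside := by
    intro x hx
    rw [Function.update_of_ne (by rintro rfl; exact hx hc)]
    exact F.outside x hx
  hole_mem := F.mem c hc
  mem := by
    intro x hx
    by_cases h : x = c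
    · subst h; simpa using F.hole_mem
    · rw [Function.update_of_ne h]; exact F.mem x hx
  ne := by
    intro x hx
    by_cases h : x = c
    · subst h; simpa using (F.ne x hc).symm
    · rw [Function.update_of_ne h]; exact fun he => h (F.inj_s11 x hx c hc he)
  inj_s11 := by
    intro x hx y hy
    by_cases h : x = c
    · by_cases h' : y = c
      · intro; rw [h, h']
      · rw [h, Function.update_of_ne h', Function.update_self]
        intro he; exact absurd he.symm (F.ne y hy)
    · by_cases h' : y = c
      · rw [h', Function.update_of_ne h, Function.update_self]
        intro he; exact absurd he (F.ne x hx)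
      · rw [Function.update_of_ne h, Function.update_of_ne h']
        exact F.inj_s11 x hx y hy
  lt := by
    intro x y hxy hy
    by_cases h : x = c
    · subst h
      rw [Function.update_self, Function.update_of_ne hxy.ne']
      exact h2 y hxy hy
    · by_cases h' : y = c
      · subst h'
        rw [Function.update_self, Function.update_of_ne hxy.ne]
        exact h1 x hxy
      · rw [Function.update_of_ne h, Function.update_of_ne h']
        exact F.lt x y hxy hy

theorem toggle {μ : YoungDiagram} (c : ℕ × ℕ) (hc : c ∈ μ) :
    Nat.card {F : Aug μ // Addb (augIdl F) c} = Nat.card {F : Aug μ // Remb (augIdl F) c} := by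
  refine Nat.card_congr
    { toFun := fun F => ⟨swapA F.1 c hc ((addb_aug _ _ hc).1 F.2).2
        (fun x hx hm => ((addb_aug _ _ hc).1 F.2).1.trans (F.1.lt c x hx hm)), ?_⟩
      invFun := fun F => ⟨swapA F.1 c hc
        (fun x hx => (F.1.lt x c hx hc).trans ((remb_aug _ _ hc).1 F.2).1)
        ((remb_aug _ _ hc).1 F.2).2, ?_⟩
      left_inv := ?_
      right_inv := ?_ }
  · rw [remb_aug _ _ hc]
    have h := (addb_aug _ _ hc).1 F.2
    simp only [swapA, Function.update_self]
    refine ⟨h.1, fun x hx hm => ?_⟩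
    rw [Function.update_of_ne hx.ne']
    exact F.1.lt c x hx hm
  · rw [addb_aug _ _ hc]
    have h := (remb_aug _ _ hc).1 F.2
    simp only [swapA, Function.update_self]
    refine ⟨h.1, fun x hx => ?_⟩
    rw [Function.update_of_ne hx.ne]
    exact F.1.lt x c hx hc
  · intro F
    apply Subtype.ext
    apply Aug.ext'_s11 <;> simp [swapA]
  · intro F
    apply Subtype.ext
    apply Aug.ext'_s11 <;> simp [swapA]

theorem _root_.SBSVT.ext'_s11 {μ : YoungDiagram} {T S : SBSVT μ} (h : T.entry = S.entry) : T = S := by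
  cases T; cases S; simp_all

theorem Aug.surj {μ : YoungDiagram} (F : Aug μ) (k : ℕ) (h1 : 1 ≤ k) (h2 : k ≤ μ.card + 1)
    (h3 : k ≠ F.hole) : ∃ x ∈ μ, F.entry x = k := by
  have := Finset.surjOn_of_injOn_of_card_le (s := μ.cells)
    (t := (Finset.Icc 1 (μ.card + 1)).erase F.hole) F.entry
    (by
      intro x hx
      have hx' : x ∈ μ := by simpa using hx
      have := F.mem x hx'
      have := F.ne x hx'
      simp; omega)
    (by
      intro x hx y hy h
      exact F.inj_s11 x (by simpa using hx) y (by simpa using hy) h)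
    (by
      rw [Finset.card_erase_of_mem (by have := F.hole_mem; simp; omega)]
      simp)
  obtain ⟨x, hx, he⟩ := this (a := k) (by simp; omega)
  exact ⟨x, by simpa using hx, he⟩

/-- from augmented tableau with removable cell to set-valued tableau -/
def toSB {μ : YoungDiagram} (F : Aug μ) (c : ℕ × ℕ) (hr : Remb (augIdl F) c) : SBSVT μ where
  entry x := if x = c then {F.entry c, F.hole} else if x ∈ μ then {F.entry x} else ∅
  outside := by
    intro x hx
    have hc := augIdl_le F hr.1
    rw [if_neg (by rintro rfl; exact hx hc), if_neg hx]
  nonempty := by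
    intro x hx
    split_ifs <;> simp
  card_le := by
    intro x hx
    split_ifs
    · exact Finset.card_le_two
    · simp
  unique_double := by
    have hc := augIdl_le F hr.1
    refine ⟨c, ⟨hc, ?_⟩, ?_⟩
    · simp only [if_true]
      exact Finset.card_pair (F.ne c hc)
    · rintro y ⟨hy, h⟩
      by_contra hne
      simp [hne, hy] at h
  mem_range := by
    intro x hx k hk
    have hc := augIdl_le F hr.1
    have h1 := F.mem x hx
    have h2 := F.hole_mem
    have h3 := F.mem c hc
    split_ifs at hk
    · simp at hk ⊢; omega
    · simp at hk ⊢; omega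
  exactly_once := by
    intro k hk
    have hc := augIdl_le F hr.1
    simp only [Finset.mem_Icc] at hk
    by_cases hh : k = F.hole
    · refine ⟨c, ⟨hc, by simp [hh]⟩, ?_⟩
      rintro y ⟨hy, h⟩
      by_contra hne
      simp [hne, hy] at h
      exact F.ne y hy (by omega)
    · obtain ⟨x, hx, he⟩ := F.surj k hk.1 hk.2 hh
      refine ⟨x, ⟨hx, ?_⟩, ?_⟩
      · split_ifs with h
        · subst h; simp [he]
        · simp [he]
      · rintro y ⟨hy, h⟩
        refine F.inj_s11 y hy x hx ?_
        split_ifs at h with h'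
        · subst h'
          simp at h; omega
        · simp at h; omega
  row_le := by
    intro i j1 j2 hj hm p hp q hq
    have hc := augIdl_le F hr.1
    have hlt : (i, j1) < (i, j2) := by rw [Prod.lt_iff]; right; simpa using hj
    exact (sb_lt F c hr hlt hm p hp q hq).le
  col_lt := by
    intro i1 i2 j hj hm p hp q hq
    have hc := augIdl_le F hr.1
    have hlt : (i1, j) < (i2, j) := by rw [Prod.lt_iff]; left; simpa using hj
    exact (sb_lt F c hr hlt hm p hp q hq)
where
  sb_lt {μ : YoungDiagram} (F : Aug μ) (c : ℕ × ℕ) (hr : Remb (augIdl F) c) {x y : ℕ × ℕ}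
    (hlt : x < y) (hy : y ∈ μ) (p : ℕ)
    (hp : p ∈ (if x = c then {F.entry c, F.hole} else if x ∈ μ then {F.entry x} else ∅ : Finset ℕ))
    (q : ℕ)
    (hq : q ∈ (if y = c then {F.entry c, F.hole} else if y ∈ μ then {F.entry y} else ∅ : Finset ℕ)) :
    p < q := by
    have hc := augIdl_le F hr.1
    rw [remb_aug _ _ hc] at hr
    have hx := mem_of_le' hlt.le hy
    have h0 := F.lt x y hlt hy
    by_cases h : x = c
    · subst h
      have := hr.2 y hlt hy
      simp [hlt.ne', hy] at hp hq
      omega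
    · by_cases h' : y = c
      · subst h'
        simp [h, hx] at hp hq
        omega
      · simp [h, h', hx, hy] at hp hq
        omega

theorem toSB_bij (μ : YoungDiagram) : Function.Bijective
    (fun P : (Σ F : Aug μ, {c // Remb (augIdl F) c}) => toSB P.1 P.2.1 P.2.2) := by
  constructor
  · rintro ⟨F, c, hF⟩ ⟨G, c', hG⟩ h
    have he := congrArg SBSVT.entry h
    simp only [toSB] at he
    have hc := augIdl_le F hF.1
    have hc' := augIdl_le G hG.1
    have hcc : c = c' := by
      by_contra hne
      have h1 := congrArg Finset.card (congrFun he c)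
      simp only [if_true, hne, if_false, hc] at h1
      rw [Finset.card_pair (F.ne c hc)] at h1
      simp at h1
    subst hcc
    have hp := congrFun he c
    simp only [if_true] at hp
    have hF' := ((remb_aug _ _ hc).1 hF).1
    have hG' := ((remb_aug _ _ hc).1 hG).1
    have m1 : F.entry c ∈ ({G.entry c, G.hole} : Finset ℕ) := by rw [← hp]; simp
    have m2 : F.hole ∈ ({G.entry c, G.hole} : Finset ℕ) := by rw [← hp]; simp
    simp only [Finset.mem_insert, Finset.mem_singleton] at m1 m2
    have hFG : F = G := by
      apply Aug.ext'_s11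
      · funext x
        by_cases hx : x = c
        · subst hx; omega
        · by_cases hxm : x ∈ μ
          · have := congrFun he x
            simpa [hx, hxm] using this
          · rw [F.outside x hxm, G.outside x hxm]
      · omega
    subst hFG
    rfl
  · intro S
    obtain ⟨c, ⟨hc, hc2⟩, hcu⟩ := S.unique_double
    simp only at hcu
    have hone : ∀ x ∈ μ, x ≠ c → ∃ k, S.entry x = {k} := by
      intro x hx hne
      rw [← Finset.card_eq_one]
      have h1 := (S.nonempty x hx).card_pos
      have h2 := S.card_le x hx
      have h3 : (S.entry x).card ≠ 2 := fun h => hne (hcu x ⟨hx, h⟩)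
      omega
    obtain ⟨m, v, hmv, hm⟩ : ∃ m v, m < v ∧ S.entry c = {m, v} := by
      obtain ⟨m, v, hne, he⟩ := Finset.card_eq_two.1 hc2
      rcases lt_or_gt_of_ne hne with h | h
      · exact ⟨m, v, h, he⟩
      · exact ⟨v, m, h, by rw [he, Finset.pair_comm]⟩
    have huniq : ∀ x ∈ μ, ∀ y ∈ μ, ∀ k, k ∈ S.entry x → k ∈ S.entry y → x = y := by
      intro x hx y hy k h1 h2
      obtain ⟨z, _, hz⟩ := S.exactly_once k (S.mem_range x hx h1)
      rw [hz x ⟨hx, h1⟩, hz y ⟨hy, h2⟩]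
    have hle : ∀ x y, x < y → y ∈ μ → ∀ p ∈ S.entry x, ∀ q ∈ S.entry y, p < q := by
      rintro ⟨i, j⟩ ⟨i', j'⟩ h hy p hp q hq
      have hle := h.le
      rw [Prod.mk_le_mk] at hle
      have hmid : (i, j') ∈ μ := μ.up_left_mem hle.1 le_rfl hy
      have hpq : p ≤ q := by
        rcases eq_or_lt_of_le hle.2 with h2 | h2
        · rcases eq_or_lt_of_le hle.1 with h3 | h3
          · exact absurd (by rw [h2, h3]) h.ne
          · subst h2
            exact (S.col_lt i i' j h3 hy p hp q hq).le
        · obtain ⟨r, hr⟩ := S.nonempty _ hmid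
          rcases eq_or_lt_of_le hle.1 with h3 | h3
          · subst h3
            exact S.row_le i j j' h2 hy p hp q hq
          · exact (S.row_le i j j' h2 hmid p hp r hr).trans
              (S.col_lt i i' j' h3 hy r hr q hq).le
      refine lt_of_le_of_ne hpq ?_
      rintro rfl
      exact h.ne (huniq _ (mem_of_le' h.le hy) _ hy p hp hq)
    have hf : ∃ f : ℕ × ℕ → ℕ, f c = m ∧ (∀ x ∈ μ, x ≠ c → S.entry x = {f x}) ∧
        ∀ x, x ∉ μ → f x = 0 := by
      classical
      refine ⟨fun x => if x = c then m else if h : x ∈ μ ∧ x ≠ c then (hone x h.1 h.2).choose else 0,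
        by simp, ?_, ?_⟩
      · intro x hx hne
        simp only [if_neg hne]
        rw [dif_pos ⟨hx, hne⟩]
        exact (hone x hx hne).choose_spec
      · intro x hx
        have : x ≠ c := by rintro rfl; exact hx hc
        simp [this, hx]
    obtain ⟨f, hfc, hf1, hf0⟩ := hf
    have hfm : ∀ x ∈ μ, f x ∈ S.entry x := by
      intro x hx
      by_cases h : x = c
      · subst h; rw [hm, hfc]; simp
      · rw [hf1 x hx h]; simp
    have hvm : v ∈ S.entry c := by rw [hm]; simp
    let F : Aug μ :=
      { entry := f
        hole := v
        outside := hf0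
        hole_mem := by simpa using S.mem_range c hc hvm
        mem := fun x hx => by simpa using S.mem_range x hx (hfm x hx)
        ne := by
          intro x hx h
          by_cases hxc : x = c
          · subst hxc; omega
          · exact hxc (huniq x hx c hc v (h ▸ hfm x hx) hvm)
        inj_s11 := fun x hx y hy h => huniq x hx y hy (f x) (hfm x hx) (h ▸ hfm y hy)
        lt := fun x y h hy => hle x y h hy _ (hfm x (mem_of_le' h.le hy)) _ (hfm y hy) }
    have hr : Remb (augIdl F) c := by
      rw [remb_aug _ _ hc]
      refine ⟨by simpa [F, hfc] using hmv, fun x hx hxm => ?_⟩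
      exact hle c x hx hxm v hvm _ (hfm x hxm)
    refine ⟨⟨F, c, hr⟩, ?_⟩
    apply SBSVT.ext'_s11
    funext x
    simp only [toSB]
    split_ifs with h1 h2
    · subst h1; simp [F, hfc, hm]
    · simp [F, hf1 x h2 h1]
    · exact (S.outside x h2).symm

theorem card_sytIdl {μ : YoungDiagram} (T : SYT μ) (k : ℕ) (hk : k ≤ μ.card) :
    (sytIdl T k).card = k := by
  have h : (sytIdl T k).cells.card = (Finset.Icc 1 k).card := by
    refine Finset.card_nbij T.entry ?_ ?_ ?_
    · intro x hx
      have hx' := (mem_sytIdl T k x).1 (by simpa using hx)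
      have := T.mem_range hx'.1
      simp; omega
    · intro x hx y hy h
      exact T.inj_s11 ((mem_sytIdl T k x).1 (by simpa using hx)).1
        ((mem_sytIdl T k y).1 (by simpa using hy)).1 h
    · intro v hv
      simp at hv
      obtain ⟨x, hx, he⟩ := T.bijOn.surjOn (show v ∈ Set.Icc 1 μ.card from ⟨hv.1, by omega⟩)
      refine ⟨x, ?_, he⟩
      have : x ∈ sytIdl T k := (mem_sytIdl T k x).2 ⟨by simpa using hx, by omega⟩
      simpa using this
  simpa using h

/-- element of the interval -/
def pIdl {μ : YoungDiagram} (T : SYT μ) (k : Fin (μ.card + 1)) : {ν : YoungDiagram // ν ≤ μ} :=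
  ⟨sytIdl T k, fun _ hx => ((mem_sytIdl T k _).1 hx).1⟩

theorem card_pIdl {μ : YoungDiagram} (T : SYT μ) (k : Fin (μ.card + 1)) :
    (pIdl T k).1.card = k := card_sytIdl T k (by have := k.2; omega)

theorem pIdl_inj {μ : YoungDiagram} (T : SYT μ) : Function.Injective (pIdl T) := by
  intro k k' h
  apply Fin.ext
  rw [← card_pIdl T k, ← card_pIdl T k', h]

theorem eq_of_chain {μ : YoungDiagram} {C : Set {ν : YoungDiagram // ν ≤ μ}}
    (hC : IsChain (· ≤ ·) C) {p q : {ν : YoungDiagram // ν ≤ μ}} (hp : p ∈ C) (hq : q ∈ C)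
    (h : p.1.card ≤ q.1.card) : p ≤ q := by
  rcases hC.total hp hq with h1 | h1
  · exact h1
  · exact (Subtype.ext (eq_of_le_card (Subtype.coe_le_coe.2 h1) h)).ge

theorem range_pIdl_max {μ : YoungDiagram} (T : SYT μ) :
    IsMaxChain (· ≤ ·) (Set.range (pIdl T)) := by
  constructor
  · rintro _ ⟨k, rfl⟩ _ ⟨k', rfl⟩ _
    rcases le_total k k' with h | h
    · left
      intro x hx
      have := (mem_sytIdl T k x).1 hx
      exact (mem_sytIdl T k' x).2 ⟨this.1, this.2.trans h⟩
    · right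
      intro x hx
      have := (mem_sytIdl T k' x).1 hx
      exact (mem_sytIdl T k x).2 ⟨this.1, this.2.trans h⟩
  · intro C hC hsub
    refine Set.Subset.antisymm hsub ?_
    intro p hp
    have hcard : p.1.card < μ.card + 1 := Nat.lt_succ_of_le (card_le' p.2)
    refine ⟨⟨p.1.card, hcard⟩, ?_⟩
    have hm : pIdl T ⟨p.1.card, hcard⟩ ∈ C := hsub ⟨_, rfl⟩
    have hc := card_pIdl T ⟨p.1.card, hcard⟩
    simp only at hc
    exact le_antisymm (eq_of_chain hC hm hp hc.le) (eq_of_chain hC hp hm hc.ge)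

theorem range_inj {μ : YoungDiagram} :
    Function.Injective (fun T : SYT μ => Set.range (pIdl T)) := by
  intro T S h
  simp only at h
  have hk : ∀ k, pIdl T k = pIdl S k := by
    intro k
    have : pIdl T k ∈ Set.range (pIdl S) := h ▸ ⟨k, rfl⟩
    obtain ⟨k', hk'⟩ := this
    have : k' = k := by
      apply Fin.ext
      rw [← card_pIdl T k, ← card_pIdl S k', hk']
    rw [← hk', this]
  have hmem : ∀ x ∈ μ, ∀ k ≤ μ.card, (T.entry x ≤ k ↔ S.entry x ≤ k) := by
    intro x hx k hk'
    have h1 := congrArg (fun p => x ∈ p.1) (hk ⟨k, by omega⟩)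
    simp only [pIdl, mem_sytIdl, hx, true_and, eq_iff_iff] at h1
    exact h1
  apply SYT.ext'_s11
  funext x
  by_cases hx : x ∈ μ
  · have h1 := T.mem_range hx
    have h2 := S.mem_range hx
    have h3 := hmem x hx (T.entry x) h1.2
    have h4 := hmem x hx (S.entry x) h2.2
    omega
  · rw [T.outside x hx, S.outside x hx]

instance finI (μ : YoungDiagram) : Finite {ν : YoungDiagram // ν ≤ μ} := by
  refine Finite.of_injective
    (fun p : {ν : YoungDiagram // ν ≤ μ} =>
      (⟨p.1.cells, Finset.mem_powerset.2 (YoungDiagram.cells_subset_iff.2 p.2)⟩ :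
        {s // s ∈ μ.cells.powerset})) ?_
  intro p q h
  apply Subtype.ext
  apply YoungDiagram.ext
  exact congrArg Subtype.val h

instance finSYT (μ : YoungDiagram) : Finite (SYT μ) := Finite.of_injective _ range_inj

instance finAug (μ : YoungDiagram) : Finite (Aug μ) := Finite.of_equiv _ (augEquiv μ).symm

theorem exists_card {μ : YoungDiagram} {C : Set {ν : YoungDiagram // ν ≤ μ}}
    (hC : IsMaxChain (· ≤ ·) C) (k : ℕ) (hk : k ≤ μ.card) : ∃ p ∈ C, p.1.card = k := by
  by_contra hno
  push Not at hno
  have hfin : C.Finite := Set.toFinite C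
  have hbot : (⟨⊥, bot_le⟩ : {ν : YoungDiagram // ν ≤ μ}) ∈ C := by
    by_contra hb
    have := hC.2 (t := insert ⟨⊥, bot_le⟩ C)
      (hC.1.insert (fun b _ _ => Or.inl (bot_le (a := b.1)))) (Set.subset_insert _ _)
    rw [this] at hb
    exact hb (Set.mem_insert _ _)
  have htop : (⟨μ, le_rfl⟩ : {ν : YoungDiagram // ν ≤ μ}) ∈ C := by
    by_contra hb
    have := hC.2 (t := insert ⟨μ, le_rfl⟩ C)
      (hC.1.insert (fun b _ _ => Or.inr b.2)) (Set.subset_insert _ _)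
    rw [this] at hb
    exact hb (Set.mem_insert _ _)
  obtain ⟨p, ⟨hpC, hpk⟩, hp⟩ := Set.exists_max_image {p ∈ C | p.1.card ≤ k} (fun p => p.1.card)
    (hfin.subset (fun _ h => h.1)) ⟨_, hbot, by simp [YoungDiagram.card]⟩
  obtain ⟨q, ⟨hqC, hqk⟩, hq⟩ := Set.exists_min_image {p ∈ C | k ≤ p.1.card} (fun p => p.1.card)
    (hfin.subset (fun _ h => h.1)) ⟨_, htop, hk⟩
  have hp1 := hno p hpC
  have hq1 := hno q hqC
  have hlt : p.1 < q.1 := by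
    refine lt_of_le_of_ne (Subtype.coe_le_coe.2 (eq_of_chain hC.1 hpC hqC (by omega))) ?_
    intro h; rw [h] at hpk; omega
  obtain ⟨c, hc, hcq⟩ := exists_addb hlt
  have hrq : insC p.1 c hc ≤ q.1 := by
    intro x hx
    rcases (mem_insC hc).1 hx with h | h
    · rw [h]; exact hcq
    · exact hlt.le h
  have hpr : p.1 ≤ insC p.1 c hc := fun x hx => (mem_insC hc).2 (Or.inr hx)
  have hrC : (⟨insC p.1 c hc, hrq.trans q.2⟩ : {ν : YoungDiagram // ν ≤ μ}) ∈ C := by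
    by_contra hb
    have := hC.2 (t := insert ⟨insC p.1 c hc, hrq.trans q.2⟩ C)
      (hC.1.insert (fun s hs _ => ?_)) (Set.subset_insert _ _)
    · rw [this] at hb
      exact hb (Set.mem_insert _ _)
    · rcases le_total s.1.card k with h | h
      · right
        exact (Subtype.coe_le_coe.2 (eq_of_chain hC.1 hs hpC (hp s ⟨hs, h⟩))).trans hpr
      · left
        exact hrq.trans (Subtype.coe_le_coe.2 (eq_of_chain hC.1 hqC hs (hq s ⟨hs, h⟩)))
  have h1 := hp _ ⟨hrC, by rw [card_insC]; omega⟩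
  simp only [card_insC] at h1
  omega

theorem range_surj {μ : YoungDiagram} {C : Set {ν : YoungDiagram // ν ≤ μ}}
    (hC : IsMaxChain (· ≤ ·) C) : ∃ T : SYT μ, Set.range (pIdl T) = C := by
  classical
  have hex : ∀ x ∈ μ, ∃ k, ∃ p ∈ C, p.1.card = k ∧ x ∈ p.1 := by
    intro x hx
    obtain ⟨p, hp, hpc⟩ := exists_card hC μ.card le_rfl
    have : p.1 = μ := eq_of_le_card p.2 hpc.ge
    exact ⟨_, p, hp, hpc, by rw [this]; exact hx⟩
  let f : ℕ × ℕ → ℕ := fun x => if h : x ∈ μ then Nat.find (hex x h) else 0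
  have hf : ∀ x ∈ μ, ∀ p ∈ C, (x ∈ p.1 ↔ f x ≤ p.1.card) := by
    intro x hx p hp
    simp only [f, dif_pos hx]
    constructor
    · intro h
      exact Nat.find_min' _ ⟨p, hp, rfl, h⟩
    · intro h
      obtain ⟨q, hq, hqc, hxq⟩ := Nat.find_spec (hex x hx)
      exact (eq_of_chain hC.1 hq hp (hqc.trans_le h)) hxq
  have hr : ∀ x ∈ μ, 1 ≤ f x ∧ f x ≤ μ.card := by
    intro x hx
    constructor
    · by_contra h
      obtain ⟨p, hp, hpc⟩ := exists_card hC 0 (Nat.zero_le _)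
      have h1 := (hf x hx p hp).2 (by omega)
      have h2 : p.1.cells = ∅ := Finset.card_eq_zero.1 hpc
      rw [← YoungDiagram.mem_cells, h2] at h1
      simp at h1
    · obtain ⟨p, hp, hpc⟩ := exists_card hC μ.card le_rfl
      have : p.1 = μ := eq_of_le_card p.2 hpc.ge
      rw [← hpc]
      exact (hf x hx p hp).1 (by rw [this]; exact hx)
  have hi : ∀ x ∈ μ, ∀ y ∈ μ, f x = f y → x = y := by
    intro x hx y hy h
    have h1 := hr x hx
    obtain ⟨p, hp, hpc⟩ := exists_card hC (f x) h1.2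
    obtain ⟨q, hq, hqc⟩ := exists_card hC (f x - 1) (by omega)
    have hqp : q ≤ p := eq_of_chain hC.1 hq hp (by omega)
    have hqp' : q.1.cells ⊆ p.1.cells := YoungDiagram.cells_subset_iff.2 hqp
    have hd : (p.1.cells \ q.1.cells).card ≤ 1 := by
      rw [Finset.card_sdiff_of_subset hqp']
      change p.1.card - q.1.card ≤ 1
      omega
    rw [Finset.card_le_one] at hd
    refine hd x ?_ y ?_
    · rw [Finset.mem_sdiff, YoungDiagram.mem_cells, YoungDiagram.mem_cells, hf x hx p hp,
        hf x hx q hq]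
      omega
    · rw [Finset.mem_sdiff, YoungDiagram.mem_cells, YoungDiagram.mem_cells, hf y hy p hp,
        hf y hy q hq]
      omega
  have hl : ∀ x y, x < y → y ∈ μ → f x < f y := by
    intro x y hxy hy
    have hx := mem_of_le' hxy.le hy
    refine lt_of_le_of_ne ?_ (fun h => hxy.ne (hi x hx y hy h))
    obtain ⟨p, hp, hpc⟩ := exists_card hC (f y) (hr y hy).2
    rw [← hpc]
    refine (hf x hx p hp).1 (mem_of_le' hxy.le ((hf y hy p hp).2 hpc.ge))
  refine ⟨mkSYT μ f (fun c hc => by simp [f, hc]) hr hi hl, ?_⟩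
  refine (range_pIdl_max _).2 hC.1 ?_
  rintro _ ⟨k, rfl⟩
  obtain ⟨p, hp, hpc⟩ := exists_card hC k (by have := k.2; omega)
  convert hp
  apply Subtype.ext
  apply SetLike.ext
  intro x
  simp only [pIdl, mem_sytIdl]
  constructor
  · rintro ⟨hx, h⟩
    rw [hf x hx p hp, hpc]; exact h
  · intro hx
    have hx' := p.2 hx
    exact ⟨hx', by rw [hf x hx' p hp, hpc] at hx; exact hx⟩

theorem maxChains_eq (μ : YoungDiagram) :
    {C : Set {ν : YoungDiagram // ν ≤ μ} | IsMaxChain (· ≤ ·) C}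
      = Set.range (fun T : SYT μ => Set.range (pIdl T)) := by
  ext C
  constructor
  · intro h
    exact range_surj h
  · rintro ⟨T, rfl⟩
    exact range_pIdl_max T

instance neSYT (μ : YoungDiagram) : Nonempty (SYT μ) := by
  obtain ⟨C, hC, _⟩ := (IsChain.empty (r := (· ≤ ·)) (α := {ν : YoungDiagram // ν ≤ μ})).exists_maxChain
  obtain ⟨T, _⟩ := range_surj hC
  exact ⟨T⟩

open Classical in
theorem card_SB (μ : YoungDiagram) [Fintype (Aug μ)] :
    Nat.card (SBSVT μ) = ∑ F : Aug μ, rem (augIdl F) := by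
  rw [← Nat.card_congr (Equiv.ofBijective _ (toSB_bij μ))]
  have : ∀ F : Aug μ, Nat.card {c // Remb (augIdl F) c} = rem (augIdl F) := by
    intro F
    unfold rem
    rw [Nat.subtype_card]
    intro x
    simp only [Finset.mem_filter, YoungDiagram.mem_cells]
    exact ⟨fun h => h.2, fun h => ⟨h.1, h⟩⟩
  have hfin : ∀ F : Aug μ, Finite {c // Remb (augIdl F) c} := fun F =>
    Set.Finite.subset (Finset.finite_toSet μ.cells)
      (fun c (hc : Remb (augIdl F) c) => by simpa using augIdl_le F hc.1)
  rw [Nat.card_sigma]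
  exact Finset.sum_congr rfl fun F _ => this F

theorem sum_pIdl (μ : YoungDiagram) [Fintype (Aug μ)] [Fintype (SYT μ)] :
    ∑ T : SYT μ, ∑ k : Fin (μ.card + 1), (rem (pIdl T k).1 : ℚ)
      = ∑ F : Aug μ, (rem (augIdl F) : ℚ) := by
  rw [← Fintype.sum_prod_type' (fun (T : SYT μ) k => (rem (pIdl T k).1 : ℚ))]
  exact (Fintype.sum_equiv (augEquiv μ) _ _ (fun F => rfl)).symm

theorem EY_eq (μ : YoungDiagram) [Fintype (Aug μ)] :
    EY {ν : YoungDiagram // ν ≤ μ}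
      = (∑ F : Aug μ, (rem (augIdl F) : ℚ)) / (((μ.card : ℚ) + 1) * Nat.card (SYT μ)) := by
  classical
  haveI : Fintype (SYT μ) := Fintype.ofFinite _
  unfold EY
  rw [maxChains_eq, finsum_mem_range range_inj, finsum_mem_range range_inj,
    finsum_eq_sum_of_fintype, finsum_eq_sum_of_fintype, ← sum_pIdl]
  congr 1
  · refine Finset.sum_congr rfl fun T _ => ?_
    rw [finsum_mem_range (pIdl_inj T), finsum_eq_sum_of_fintype]
    exact Finset.sum_congr rfl fun k _ => by rw [downDeg_eq]
  · have : ∀ T : SYT μ, (Set.range (pIdl T)).ncard = μ.card + 1 := by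
      intro T
      rw [← Set.image_univ, Set.ncard_image_of_injective _ (pIdl_inj T), Set.ncard_univ]
      simp
    simp only [this]
    simp [mul_comm]
    ring

theorem main_sum (d a b : ℕ) (hd : 1 ≤ d) (ha : 0 < a) (hb : 0 < b)
    [Fintype (Aug (rectStaircase d a b))] :
    ((a : ℚ) + b) * (∑ F : Aug (rectStaircase d a b), (rem (augIdl F) : ℚ))
      = ((d : ℚ) - 1) * a * b * (Nat.card (Aug (rectStaircase d a b)) : ℚ) := by
  classical
  have h := Finset.sum_congr (rfl : (Finset.univ : Finset (Aug (rectStaircase d a b))) = _)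
    (fun F _ => key_identity d a b hd ha hb (augIdl F) (augIdl_le F))
  rw [Finset.sum_add_distrib, Finset.sum_sub_distrib, Finset.sum_comm,
    Finset.sum_comm (s := Finset.univ) (f := fun F c => if Remb (augIdl F) c then _ else _),
    ← Finset.mul_sum] at h
  have ht : ∀ c ∈ (rectStaircase d a b).cells,
      (∑ F : Aug (rectStaircase d a b), if Addb (augIdl F) c then pot d a b c else 0)
      = ∑ F : Aug (rectStaircase d a b), if Remb (augIdl F) c then pot d a b c else 0 := by
    intro c hc
    have := toggle c ((YoungDiagram.mem_cells c).1 hc)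
    rw [Nat.card_eq_fintype_card, Nat.card_eq_fintype_card, Fintype.card_subtype,
      Fintype.card_subtype] at this
    rw [← Finset.sum_filter, ← Finset.sum_filter, Finset.sum_const, Finset.sum_const, this]
  rw [Finset.sum_congr rfl ht, sub_self, zero_add] at h
  rw [h]
  simp [mul_comm]

end RS

/-- For the rectangular staircase `λ = δ_d ∘ (b^a)`, the maximal-chain-weighted expected
down-degree of `[∅,λ]` equals `(d-1)ab/(a+b)`; explicitly,
`f^λ(+1)/((|λ|+1)·f^λ) = (d-1)ab/(a+b)`. -/
theorem stmt11 (d a b : ℕ) (hd : 1 ≤ d) (ha : 0 < a) (hb : 0 < b) :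
    EY {μ : YoungDiagram // μ ≤ rectStaircase d a b} =
      ((d : ℚ) - 1) * a * b / (a + b) ∧
    (Nat.card (SBSVT (rectStaircase d a b)) : ℚ) /
        ((((rectStaircase d a b).card : ℚ) + 1) *
          (Nat.card (SYT (rectStaircase d a b)) : ℚ)) =
      ((d : ℚ) - 1) * a * b / (a + b) := by
  classical
  haveI : Fintype (RS.Aug (rectStaircase d a b)) := Fintype.ofFinite _
  have hpos : (a : ℚ) + b ≠ 0 := by positivity
  have hS : (Nat.card (SYT (rectStaircase d a b)) : ℚ) ≠ 0 := by
    exact_mod_cast Nat.card_pos.ne'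
  have hn : (((rectStaircase d a b).card : ℚ) + 1) ≠ 0 := by positivity
  have key : (∑ F : RS.Aug (rectStaircase d a b), (RS.rem (RS.augIdl F) : ℚ)) /
      ((((rectStaircase d a b).card : ℚ) + 1) * Nat.card (SYT (rectStaircase d a b)))
      = ((d : ℚ) - 1) * a * b / (a + b) := by
    have h := RS.main_sum d a b hd ha hb
    rw [Nat.card_congr (RS.augEquiv _), Nat.card_prod] at h
    simp only [Nat.card_eq_fintype_card (α := Fin _), Fintype.card_fin] at h
    push_cast at h
    rw [div_eq_div_iff (mul_ne_zero hn hS) hpos]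
    linear_combination h
  refine ⟨by rw [RS.EY_eq, key], ?_⟩
  rw [RS.card_SB]
  push_cast
  exact key
end
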